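/- Let k be a field of characteristic zero and X a set with five elements. Then the Jacobson radical J(𝓡_X) of the monoid algebra 𝓡_X = k𝓒(X,X) of the monoid of relations on X has dimension 29446050 as a k-vector space. -/

import Mathlib

/-- Composition of correspondences: `rcomp R S = {(z,x) | ∃ y, (z,y) ∈ R ∧ (y,x) ∈ S}`. -/
def rcomp {α β γ : Type*} (R : Set (γ × β)) (S : Set (β × α)) : Set (γ × α) :=
  {p | ∃ y, (p.1, y) ∈ R ∧ (y, p.2) ∈ S}

/-- The diagonal relation. -/
def diag (X : Type*) : Set (X × X) := {p | p.1 = p.2}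

theorem rcomp_assoc {α β γ δ : Type*} (R : Set (δ × γ)) (S : Set (γ × β)) (T : Set (β × α)) :
    rcomp (rcomp R S) T = rcomp R (rcomp S T) := by
  ext ⟨z, x⟩
  constructor
  · rintro ⟨y, ⟨w, hw1, hw2⟩, hy⟩
    exact ⟨w, hw1, y, hw2, hy⟩
  · rintro ⟨w, hw, y, hy1, hy2⟩
    exact ⟨y, ⟨w, hw, hy1⟩, hy2⟩

theorem diag_rcomp {α β : Type*} (R : Set (β × α)) : rcomp (diag β) R = R := by
  ext ⟨z, x⟩
  simp [rcomp, diag]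

theorem rcomp_diag {α β : Type*} (R : Set (β × α)) : rcomp R (diag α) = R := by
  ext ⟨z, x⟩
  simp [rcomp, diag]

/-- The monoid `𝓒(X,X)` of all relations on `X` under composition of correspondences,
with identity the diagonal `Δ_X`. -/
instance relMonoid (X : Type*) : Monoid (Set (X × X)) where
  mul := rcomp
  one := diag X
  mul_assoc := rcomp_assoc
  one_mul := diag_rcomp
  mul_one := rcomp_diag

notation:75 R:75 " ⊚ " S:76 => rcomp R S

section Relations

variable {α β γ E X : Type*}

theorem rcomp_mono {R R' : Set (γ × β)} {S S' : Set (β × α)} (h : R ⊆ R') (h' : S ⊆ S') :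
    R ⊚ S ⊆ R' ⊚ S' := fun _ ⟨y, h1, h2⟩ => ⟨y, h h1, h' h2⟩

/-- Partial orders, as relations. -/
structure IsPO (R : Set (E × E)) : Prop where
  refl : ∀ a, (a, a) ∈ R
  trans : ∀ {a b c}, (a, b) ∈ R → (b, c) ∈ R → (a, c) ∈ R
  antisymm : ∀ {a b}, (a, b) ∈ R → (b, a) ∈ R → a = b

theorem IsPO.rcomp_self {R : Set (E × E)} (h : IsPO R) : R ⊚ R = R := by
  ext ⟨a, b⟩
  exact ⟨fun ⟨_, h1, h2⟩ => h.trans h1 h2, fun h1 => ⟨a, h.refl a, h1⟩⟩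

/-- Relabel the target of a relation. -/
def lact (τ : Equiv.Perm E) (ψ : Set (E × α)) : Set (E × α) := {p | (τ p.1, p.2) ∈ ψ}

/-- Relabel the source of a relation. -/
def ract (τ : Equiv.Perm E) (φ : Set (α × E)) : Set (α × E) := {p | (p.1, τ p.2) ∈ φ}

/-- Relabel both sides of a relation. -/
def bact (τ : Equiv.Perm E) (R : Set (E × E)) : Set (E × E) := {p | (τ p.1, τ p.2) ∈ R}

theorem mem_lact {τ : Equiv.Perm E} {ψ : Set (E × α)} {e : E} {x : α} :
    (e, x) ∈ lact τ ψ ↔ (τ e, x) ∈ ψ := Iff.rfl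

theorem mem_ract {τ : Equiv.Perm E} {φ : Set (α × E)} {e : E} {x : α} :
    (x, e) ∈ ract τ φ ↔ (x, τ e) ∈ φ := Iff.rfl

theorem mem_bact {τ : Equiv.Perm E} {R : Set (E × E)} {a b : E} :
    (a, b) ∈ bact τ R ↔ (τ a, τ b) ∈ R := Iff.rfl

theorem lact_rcomp (τ : Equiv.Perm E) (ψ : Set (E × β)) (Q : Set (β × α)) :
    lact τ ψ ⊚ Q = lact τ (ψ ⊚ Q) := rfl

theorem rcomp_ract (τ : Equiv.Perm E) (Q : Set (α × β)) (φ : Set (β × E)) :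
    Q ⊚ ract τ φ = ract τ (Q ⊚ φ) := rfl

theorem lact_ract (τ : Equiv.Perm E) (R : Set (E × E)) : lact τ (ract τ R) = bact τ R := rfl

theorem lact_mul (σ τ : Equiv.Perm E) (ψ : Set (E × α)) :
    lact (σ * τ) ψ = lact τ (lact σ ψ) := rfl

theorem ract_mul (σ τ : Equiv.Perm E) (φ : Set (α × E)) :
    ract (σ * τ) φ = ract τ (ract σ φ) := rfl

theorem bact_mul (σ τ : Equiv.Perm E) (R : Set (E × E)) :
    bact (σ * τ) R = bact τ (bact σ R) := rfl

theorem bact_injective (τ : Equiv.Perm E) : Function.Injective (bact τ) := by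
  intro R S h
  have := congrArg (bact τ⁻¹) h
  simpa [← bact_mul, bact] using this

theorem IsPO.isPO_bact {R : Set (E × E)} (h : IsPO R) (τ : Equiv.Perm E) : IsPO (bact τ R) :=
  ⟨fun a => h.refl (τ a), fun h1 h2 => h.trans h1 h2, fun h1 h2 => τ.injective (h.antisymm h1 h2)⟩

theorem IsPO.lact_inj {R : Set (E × E)} (h : IsPO R) {σ τ : Equiv.Perm E}
    (e : lact σ R = lact τ R) : σ = τ := by
  ext a
  refine h.antisymm ?_ ?_
  · have : (a, τ a) ∈ lact τ R := h.refl _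
    rwa [← e] at this
  · have : (a, σ a) ∈ lact σ R := h.refl _
    rwa [e] at this

/-- A factorization of a partial order gives a transversal of the middle set. -/
theorem IsPO.exists_transversal {R : Set (E × E)} (h : IsPO R) {u : Set (E × β)}
    {v : Set (β × E)} (huv : u ⊚ v = R) :
    ∃ f : E → β, Function.Injective f ∧ ∀ e, (e, f e) ∈ u ∧ (f e, e) ∈ v := by
  have : ∀ e, ∃ y, (e, y) ∈ u ∧ (y, e) ∈ v := by
    intro e
    have := h.refl e
    rwa [← huv] at this
  choose f hf using this
  refine ⟨f, fun a b hab => h.antisymm ?_ ?_, hf⟩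
  · rw [← huv]
    exact ⟨f a, (hf a).1, hab ▸ (hf b).2⟩
  · rw [← huv]
    exact ⟨f b, (hf b).1, hab ▸ (hf a).2⟩

theorem IsPO.card_le_of_factor [Fintype E] [Fintype β] {R : Set (E × E)} (h : IsPO R)
    {u : Set (E × β)} {v : Set (β × E)} (huv : u ⊚ v = R) :
    Fintype.card E ≤ Fintype.card β := by
  obtain ⟨f, hf, -⟩ := h.exists_transversal huv
  exact Fintype.card_le_of_injective f hf

theorem ncard_bact (τ : Equiv.Perm E) (R : Set (E × E)) : (bact τ R).ncard = R.ncard := by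
  have : bact τ R = (Equiv.prodCongr τ τ) ⁻¹' R := rfl
  rw [this]
  exact Set.ncard_preimage_of_injective_subset_range (Equiv.injective _) (by simp)

section Saturated

variable [Finite E] {R R₀ u v : Set (E × E)}

theorem IsPO.exists_perm (hR : IsPO R) (hu : u ⊚ R₀ = u) (huv : u ⊚ v = R) :
    ∃ τ : Equiv.Perm E, (∀ e, (e, τ e) ∈ u ∧ (τ e, e) ∈ v) ∧ bact τ R₀ ⊆ R := by
  obtain ⟨f, hf, h⟩ := hR.exists_transversal huv
  refine ⟨Equiv.ofBijective f (Finite.injective_iff_bijective.1 hf), h, ?_⟩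
  rintro ⟨a, b⟩ hab
  rw [← huv]
  refine ⟨f b, ?_, (h b).2⟩
  rw [← hu]
  exact ⟨f a, (h a).1, hab⟩

theorem IsPO.factor_iff (hR : IsPO R) (h₀ : IsPO R₀) (hu : u ⊚ R₀ = u)
    (hv : R₀ ⊚ v = v) (hc : R.ncard ≤ R₀.ncard) :
    u ⊚ v = R ↔ ∃ τ : Equiv.Perm E, bact τ R₀ = R ∧ lact τ R₀ = u ∧ ract τ R₀ = v := by
  constructor
  · intro huv
    obtain ⟨τ, h, hs⟩ := hR.exists_perm hu huv
    have hbact : bact τ R₀ = R :=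
      Set.eq_of_subset_of_ncard_le hs (by rwa [ncard_bact])
    refine ⟨τ, hbact, ?_, ?_⟩
    · ext ⟨a, c⟩
      constructor
      · intro hac
        rw [← hu]
        exact ⟨τ a, (h a).1, hac⟩
      · intro hac
        have : (a, τ.symm c) ∈ R := by
          rw [← huv]
          exact ⟨c, hac, by simpa using (h (τ.symm c)).2⟩
        rw [← hbact] at this
        simpa [mem_bact, mem_lact] using this
    · ext ⟨c, b⟩
      constructor
      · intro hcb
        rw [← hv]
        exact ⟨τ b, hcb, (h b).2⟩
      · intro hcb
        have : (τ.symm c, b) ∈ R := by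
          rw [← huv]
          exact ⟨c, by simpa using (h (τ.symm c)).1, hcb⟩
        rw [← hbact] at this
        simpa [mem_bact, mem_ract] using this
  · rintro ⟨τ, rfl, rfl, rfl⟩
    rw [lact_rcomp, rcomp_ract, h₀.rcomp_self, lact_ract]

end Saturated

end Relations

section Lin

variable {k G V : Type*} [Field k] [AddCommGroup V] [Module k V]

/-- Linear extension of a map defined on the basis of a monoid algebra. -/
noncomputable def lin (k : Type*) [Field k] [Module k V] (g : G → V) :
    MonoidAlgebra k G →ₗ[k] V :=
  Finsupp.linearCombination k g ∘ₗ (MonoidAlgebra.coeffLinearEquiv k).toLinearMap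

theorem lin_single (g : G → V) (x : G) (c : k) :
    lin k g (MonoidAlgebra.single x c) = c • g x := by
  simp [lin]

theorem lin_of [Monoid G] (g : G → V) (x : G) : lin k g (MonoidAlgebra.of k G x) = g x := by
  simp [MonoidAlgebra.of_apply, lin_single]

theorem linearMap_ext_of [Monoid G] {f g : MonoidAlgebra k G →ₗ[k] V}
    (h : ∀ x, f (MonoidAlgebra.of k G x) = g (MonoidAlgebra.of k G x)) : f = g := by
  refine LinearMap.ext fun a => ?_
  induction a using MonoidAlgebra.induction_linear with
  | zero => simp
  | add f g hf hg => simp [hf, hg]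
  | single a b =>
    have : MonoidAlgebra.single a b = b • MonoidAlgebra.of k G a := by simp
    rw [this, map_smul, map_smul, h]

end Lin

section RadicalSubset

open Classical in
/-- The functional `Q ↦ [ψ Q φ = R]`. -/
noncomputable def lam (k : Type*) [Field k] {E X : Type*} (R : Set (E × E)) (ψ : Set (E × X))
    (φ : Set (X × E)) : MonoidAlgebra k (Set (X × X)) →ₗ[k] k :=
  lin k fun Q => if ψ ⊚ Q ⊚ φ = R then 1 else 0

/-- The automorphism group of a relation. -/
def autGroup {E : Type*} (R : Set (E × E)) : Subgroup (Equiv.Perm E) where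
  carrier := {σ | bact σ R = R}
  mul_mem' {σ τ} hσ hτ := by
    change bact _ _ = _
    rw [bact_mul, show bact σ R = R from hσ, show bact τ R = R from hτ]
  one_mem' := rfl
  inv_mem' {σ} hσ := by
    refine bact_injective σ ?_
    rw [← bact_mul, inv_mul_cancel]
    exact hσ.symm

variable {k : Type*} [Field k] {E X : Type*}

theorem lam_of (R : Set (E × E)) (ψ : Set (E × X)) (φ : Set (X × E)) (Q : Set (X × X))
    [Decidable (ψ ⊚ Q ⊚ φ = R)] :
    lam k R ψ φ (MonoidAlgebra.of k _ Q) = if ψ ⊚ Q ⊚ φ = R then 1 else 0 := by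
  rw [lam, lin_of]
  congr

theorem lact_eq_iff {σ : Equiv.Perm E} {α : Type*} {ψ ψ' : Set (E × α)} :
    lact σ ψ = ψ' ↔ ψ = lact σ⁻¹ ψ' := by
  constructor
  · rintro rfl
    rw [← lact_mul, mul_inv_cancel]
    rfl
  · rintro rfl
    rw [← lact_mul, inv_mul_cancel]
    rfl

theorem ract_eq_iff {σ : Equiv.Perm E} {α : Type*} {ψ ψ' : Set (α × E)} :
    ract σ ψ = ψ' ↔ ψ = ract σ⁻¹ ψ' := by
  constructor
  · rintro rfl
    rw [← ract_mul, mul_inv_cancel]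
    rfl
  · rintro rfl
    rw [← ract_mul, inv_mul_cancel]
    rfl

theorem lact_inv_of_mem {R : Set (E × E)} {σ : Equiv.Perm E} (h : bact σ R = R) :
    lact σ⁻¹ R = ract σ R := by
  exact (lact_eq_iff (ψ := ract σ R).1 h).symm

theorem ract_inv_of_mem {R : Set (E × E)} {σ : Equiv.Perm E} (h : bact σ R = R) :
    ract σ⁻¹ R = lact σ R := by
  exact (ract_eq_iff (ψ := lact σ R).1 h).symm

section Rep

variable [Finite E] (R : Set (E × E)) (ψ : Set (E × X)) (φ : Set (X × E))

noncomputable instance : Fintype (autGroup R) := Fintype.ofFinite _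

open Classical in
/-- The matrix of functionals attached to a poset and a pair of saturated relations. -/
noncomputable def repMat (k : Type*) [Field k] :
    MonoidAlgebra k (Set (X × X)) →ₗ[k] Matrix (autGroup R) (autGroup R) k :=
  lin k fun Q => Matrix.of fun σ τ => if lact σ.1 ψ ⊚ Q ⊚ ract τ.1 φ = R then 1 else 0

variable {R ψ φ}

theorem repMat_mul_of (hR : IsPO R) (hψ : R ⊚ ψ = ψ) (hφ : φ ⊚ R = φ) (Q Q' : Set (X × X)) :
    repMat R ψ φ k (MonoidAlgebra.of k _ Q * MonoidAlgebra.of k _ (φ ⊚ ψ) *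
      MonoidAlgebra.of k _ Q') =
    repMat R ψ φ k (MonoidAlgebra.of k _ Q) * repMat R ψ φ k (MonoidAlgebra.of k _ Q') := by
  classical
  rw [← map_mul, ← map_mul]
  simp only [repMat, lin_of]
  ext σ τ
  simp only [Matrix.mul_apply, Matrix.of_apply]
  have key : ∀ ρ : autGroup R, (lact σ.1 ψ ⊚ Q ⊚ ract ρ.1 φ = R ∧
      lact ρ.1 ψ ⊚ Q' ⊚ ract τ.1 φ = R) ↔ (bact ρ.1 R = R ∧ lact ρ.1 R = lact σ.1 ψ ⊚ Q ⊚ φ ∧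
        ract ρ.1 R = ψ ⊚ Q' ⊚ ract τ.1 φ) := by
    intro ρ
    have hρ : bact ρ.1 R = R := ρ.2
    rw [rcomp_ract, lact_rcomp ρ.1, lact_rcomp ρ.1, lact_eq_iff, ract_eq_iff,
      lact_inv_of_mem hρ, ract_inv_of_mem hρ, eq_comm, @eq_comm _ _ (ract ρ.1 R)]
    simp [hρ]
  have main := hR.factor_iff (R₀ := R) (u := lact σ.1 ψ ⊚ Q ⊚ φ) (v := ψ ⊚ Q' ⊚ ract τ.1 φ) hR
    (by rw [rcomp_assoc, hφ]) (by rw [← rcomp_assoc, ← rcomp_assoc, hψ]) le_rfl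
  have e1 : lact σ.1 ψ ⊚ (Q * (φ ⊚ ψ) * Q') ⊚ ract τ.1 φ =
      (lact σ.1 ψ ⊚ Q ⊚ φ) ⊚ (ψ ⊚ Q' ⊚ ract τ.1 φ) := by
    change lact σ.1 ψ ⊚ (Q ⊚ (φ ⊚ ψ) ⊚ Q') ⊚ ract τ.1 φ = _
    simp only [rcomp_assoc]
  rw [e1]
  simp only [← ite_and, ite_mul, one_mul, zero_mul, key]
  by_cases h : (lact σ.1 ψ ⊚ Q ⊚ φ) ⊚ (ψ ⊚ Q' ⊚ ract τ.1 φ) = R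
  · rw [if_pos h]
    obtain ⟨ρ, h1, h2, h3⟩ := main.1 h
    rw [Finset.sum_eq_single ⟨ρ, h1⟩]
    · rw [if_pos ⟨h1, h2, h3⟩]
    · rintro ρ' - hne
      rw [if_neg]
      rintro ⟨h4, h5, h6⟩
      exact hne (Subtype.ext (hR.lact_inj (h5.trans h2.symm)))
    · simp
  · rw [if_neg h]
    symm
    refine Finset.sum_eq_zero fun ρ _ => if_neg fun hh => h (main.2 ⟨_, hh⟩)

theorem repMat_mul (hR : IsPO R) (hψ : R ⊚ ψ = ψ) (hφ : φ ⊚ R = φ)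
    (a b : MonoidAlgebra k (Set (X × X))) :
    repMat R ψ φ k (a * MonoidAlgebra.of k _ (φ ⊚ ψ) * b) =
    repMat R ψ φ k a * repMat R ψ φ k b := by
  let c := MonoidAlgebra.of k _ (φ ⊚ ψ)
  have : ((LinearMap.mul k (MonoidAlgebra k (Set (X × X)))).comp
      (LinearMap.mulRight k c)).compr₂ (repMat R ψ φ k) =
      (LinearMap.mul k (Matrix (autGroup R) (autGroup R) k)).compl₁₂ (repMat R ψ φ k)
        (repMat R ψ φ k) := by
    refine linearMap_ext_of fun Q => linearMap_ext_of fun Q' => ?_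
    exact repMat_mul_of hR hψ hφ Q Q'
  exact LinearMap.congr_fun₂ this a b

theorem repMat_trace (R : Set (E × E)) (ψ : Set (E × X)) (φ : Set (X × E))
    (a : MonoidAlgebra k (Set (X × X))) :
    (repMat R ψ φ k a).trace = (Fintype.card (autGroup R) : k) * lam k R ψ φ a := by
  classical
  have : (Matrix.traceLinearMap _ k k) ∘ₗ repMat R ψ φ k =
      (Fintype.card (autGroup R) : k) • lam k R ψ φ := by
    refine linearMap_ext_of fun Q => ?_
    simp only [repMat, LinearMap.comp_apply, LinearMap.smul_apply, lin_of,
      Matrix.traceLinearMap_apply, Matrix.trace, Matrix.diag, Matrix.of_apply, lam_of]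
    rw [Finset.sum_congr rfl (g := fun _ => if ψ ⊚ Q ⊚ φ = R then (1 : k) else 0)]
    · simp
    · intro σ _
      congr 1
      rw [rcomp_ract, lact_rcomp, lact_rcomp, eq_iff_iff]
      change bact σ.1 _ = R ↔ _
      constructor
      · intro h
        exact bact_injective σ.1 (h.trans (σ.2 : bact σ.1 R = R).symm)
      · rintro h
        rw [h]
        exact σ.2
  exact LinearMap.congr_fun this a

theorem lam_eq_zero_of_mem_jacobson [CharZero k] [Finite X] (hR : IsPO R) (hψ : R ⊚ ψ = ψ)
    (hφ : φ ⊚ R = φ) {a : MonoidAlgebra k (Set (X × X))}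
    (ha : a ∈ Ring.jacobson (MonoidAlgebra k (Set (X × X)))) : lam k R ψ φ a = 0 := by
  classical
  have : IsArtinianRing (MonoidAlgebra k (Set (X × X))) := isArtinian_of_tower k inferInstance
  obtain ⟨n, hn⟩ := IsArtinianRing.isNilpotent_jacobson_bot (R := MonoidAlgebra k (Set (X × X)))
  have hc : a * MonoidAlgebra.of k _ (φ ⊚ ψ) ∈ Ring.jacobson (MonoidAlgebra k (Set (X × X))) :=
    Ideal.mul_mem_right _ _ ha
  have hpow : (a * MonoidAlgebra.of k _ (φ ⊚ ψ)) ^ n = 0 := by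
    rw [← Ideal.jacobson_bot] at hc
    have := Ideal.pow_mem_pow hc n
    rw [hn] at this
    exact this
  have hM : ∀ j : ℕ, repMat R ψ φ k ((a * MonoidAlgebra.of k _ (φ ⊚ ψ)) ^ j * a) =
      repMat R ψ φ k a ^ (j + 1) := by
    intro j
    induction j with
    | zero => simp
    | succ j ih => rw [pow_succ', mul_assoc, repMat_mul hR hψ hφ, ih, ← pow_succ']
  have hnil : IsNilpotent (repMat R ψ φ k a) := ⟨n + 1, by rw [← hM, hpow]; simp⟩
  have htr := (Matrix.isNilpotent_trace_of_isNilpotent hnil).eq_zero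
  rw [repMat_trace] at htr
  refine (mul_eq_zero.1 htr).resolve_left ?_
  exact_mod_cast Fintype.card_ne_zero

end Rep

end RadicalSubset

section Thin

/-- The right residual `U \ U`. -/
def rightResidual {E : Type} (U : Set (E × E)) : Set (E × E) :=
  {p | ∀ z, (z, p.1) ∈ U → (z, p.2) ∈ U}

theorem rcomp_residual {E : Type} (U : Set (E × E)) : U ⊚ rightResidual U = U := by
  ext ⟨z, x⟩
  exact ⟨fun ⟨y, h1, h2⟩ => h2 z h1, fun h => ⟨x, h, fun _ h => h⟩⟩

theorem subset_residual {E : Type} {U W : Set (E × E)} (h : U ⊚ W ⊆ U) : W ⊆ rightResidual U :=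
  fun ⟨y, _⟩ hp _ hz => h ⟨y, hz, hp⟩

/-- A relation on a finite set which factors through a smaller set. -/
def Thin {E : Type} [Fintype E] (U : Set (E × E)) : Prop :=
  ∃ (B : Type) (_ : Fintype B) (u : Set (E × B)) (v : Set (B × E)),
    Fintype.card B < Fintype.card E ∧ u ⊚ v = U

variable {E : Type} [Fintype E] {U W : Set (E × E)}

theorem Thin.rcomp_left (h : Thin W) (U : Set (E × E)) : Thin (U ⊚ W) := by
  obtain ⟨B, _, u, v, hB, rfl⟩ := h
  exact ⟨B, _, U ⊚ u, v, hB, rcomp_assoc _ _ _⟩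

theorem thin_of_column (e : E) (S : Set E) (he : e ∉ S)
    (h : ∀ z, (z, e) ∈ U ↔ ∃ b ∈ S, (z, b) ∈ U) : Thin U := by
  classical
  refine ⟨{b // b ≠ e}, inferInstance, {p | (p.1, p.2.1) ∈ U},
    {p | p.1.1 = p.2 ∨ (p.2 = e ∧ p.1.1 ∈ S)}, ?_, ?_⟩
  · exact Fintype.card_subtype_lt (x := e) (by simp)
  · ext ⟨z, c⟩
    constructor
    · rintro ⟨⟨b, hb⟩, h1, h2 | ⟨h2, h3⟩⟩
      · change b = c at h2
        subst h2
        exact h1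
      · change c = e at h2
        subst h2
        exact (h z).2 ⟨b, h3, h1⟩
    · intro hz
      by_cases hc : c = e
      · subst hc
        obtain ⟨b, hb, hzb⟩ := (h z).1 hz
        exact ⟨⟨b, fun hbc => he (hbc ▸ hb)⟩, hzb, Or.inr ⟨rfl, hb⟩⟩
      · exact ⟨⟨c, hc⟩, hz, Or.inl rfl⟩

theorem exists_perm_of_not_thin (h : ¬ Thin W) : ∃ σ : Equiv.Perm E, ∀ e, (e, σ e) ∈ W := by
  classical
  let N : E → Finset E := fun e => Finset.univ.filter fun b => (e, b) ∈ W
  have hall : ∀ A : Finset E, A.card ≤ (A.biUnion N).card := by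
    intro A
    by_contra! hA
    apply h
    refine ⟨{e // e ∈ Aᶜ} ⊕ {b // b ∈ A.biUnion N}, inferInstance,
      {p | Sum.elim (fun e => e.1 = p.1) (fun b => p.1 ∈ A ∧ (p.1, b.1) ∈ W) p.2},
      {p | Sum.elim (fun e => (e.1, p.2) ∈ W) (fun b => b.1 = p.2) p.1}, ?_, ?_⟩
    · rw [Fintype.card_sum, Fintype.card_coe, Fintype.card_coe, Finset.card_compl]
      have := Finset.card_le_univ A
      omega
    · ext ⟨a, c⟩
      constructor
      · rintro ⟨⟨e, he⟩ | ⟨b, hb⟩, h1, h2⟩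
        · change e = a at h1
          subst h1
          exact h2
        · change b = c at h2
          subst h2
          exact h1.2
      · intro hac
        by_cases ha : a ∈ A
        · exact ⟨Sum.inr ⟨c, Finset.mem_biUnion.2 ⟨a, ha, by simpa [N] using hac⟩⟩,
            ⟨ha, hac⟩, rfl⟩
        · exact ⟨Sum.inl ⟨a, by simpa using ha⟩, rfl, hac⟩
  obtain ⟨f, hf, hfN⟩ := (Finset.all_card_le_biUnion_card_iff_exists_injective N).1 hall
  exact ⟨Equiv.ofBijective f (Finite.injective_iff_bijective.1 hf), fun e => by
    simpa [N] using hfN e⟩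

theorem isPO_residual (h : ¬ Thin U) : IsPO (rightResidual U) where
  refl _ _ h := h
  trans h1 h2 z hz := h2 z (h1 z hz)
  antisymm {a b} h1 h2 := by
    by_contra hne
    exact h (thin_of_column b {a} (by simpa using Ne.symm hne)
      fun z => ⟨fun hz => ⟨a, rfl, h2 z hz⟩, by rintro ⟨c, rfl, hc⟩; exact h1 z hc⟩)

theorem rcomp_eq_left_iff (h : ¬ Thin U) :
    rightResidual U ⊚ W ⊚ rightResidual U = rightResidual U ↔ U ⊚ W = U := by
  have hR := isPO_residual h
  constructor
  · intro hW
    have hsub : W ⊆ rightResidual U := by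
      rintro ⟨y, x⟩ hyx
      rw [← hW]
      exact ⟨x, ⟨y, hR.refl y, hyx⟩, hR.refl x⟩
    apply Set.Subset.antisymm
    · conv_rhs => rw [← rcomp_residual U]
      exact rcomp_mono subset_rfl hsub
    · rintro ⟨z, e⟩ hz
      have := hR.refl e
      rw [← hW] at this
      obtain ⟨x, ⟨y, h1, h2⟩, h3⟩ := this
      have hy : y = x := hR.antisymm (hsub h2) (hR.trans h3 h1)
      subst hy
      have he : e = y := hR.antisymm h1 h3
      subst he
      exact ⟨e, hz, h2⟩
  · intro hW
    have hsub := subset_residual hW.subset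
    apply Set.Subset.antisymm
    · rintro ⟨a, b⟩ ⟨x, ⟨y, h1, h2⟩, h3⟩
      exact hR.trans (hR.trans h1 (hsub h2)) h3
    · rintro ⟨a, b⟩ hab
      have hb : (b, b) ∈ W := by
        by_contra hb
        refine h (thin_of_column b {y | (y, b) ∈ W} hb fun z => ?_)
        conv_lhs => rw [← hW]
        exact ⟨fun ⟨y, h1, h2⟩ => ⟨y, h2, h1⟩, fun ⟨y, h1, h2⟩ => ⟨y, h2, h1⟩⟩
      exact ⟨b, ⟨b, hab, hb⟩, hR.refl b⟩

theorem ract_inj_of_not_thin (h : ¬ Thin U) {σ τ : Equiv.Perm E} (e : ract σ U = ract τ U) :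
    σ = τ := by
  have hR := isPO_residual h
  ext x
  refine hR.antisymm (fun z hz => ?_) (fun z hz => ?_)
  · have : (z, x) ∈ ract σ U := hz
    rwa [e] at this
  · have : (z, x) ∈ ract τ U := hz
    rwa [← e] at this

end Thin

section Nilpotent

variable (k : Type*) [Field k] (X : Type)

/-- The span of the functionals attached to finite posets. -/
noncomputable def functionals : Submodule k (Module.Dual k (MonoidAlgebra k (Set (X × X)))) :=
  Submodule.span k {f | ∃ (m : ℕ) (R : Set (Fin m × Fin m)) (ψ : Set (Fin m × X))
    (φ : Set (X × Fin m)), IsPO R ∧ R ⊚ ψ = ψ ∧ φ ⊚ R = φ ∧ f = lam k R ψ φ}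

variable {k X}

theorem mem_coann {a : MonoidAlgebra k (Set (X × X))} :
    a ∈ (functionals k X).dualCoannihilator ↔
      ∀ (m : ℕ) (R : Set (Fin m × Fin m)) (ψ : Set (Fin m × X)) (φ : Set (X × Fin m)),
        IsPO R → R ⊚ ψ = ψ → φ ⊚ R = φ → lam k R ψ φ a = 0 := by
  rw [Submodule.mem_dualCoannihilator]
  constructor
  · intro h m R ψ φ h1 h2 h3
    exact h _ (Submodule.subset_span ⟨m, R, ψ, φ, h1, h2, h3, rfl⟩)
  · intro h f hf
    induction hf using Submodule.span_induction with
    | mem f hf =>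
      obtain ⟨m, R, ψ, φ, h1, h2, h3, rfl⟩ := hf
      exact h m R ψ φ h1 h2 h3
    | zero => simp
    | add f g _ _ hf hg => simp [hf, hg]
    | smul c f _ hf => simp [hf]

theorem forall_mem_of_forall_of {G V : Type*} [Monoid G] [AddCommGroup V] [Module k V]
    (f : MonoidAlgebra k G →ₗ[k] V) (S : Submodule k V)
    (h : ∀ x, f (MonoidAlgebra.of k G x) ∈ S) (a : MonoidAlgebra k G) : f a ∈ S := by
  have : S.mkQ ∘ₗ f = 0 := linearMap_ext_of fun x => by simpa using h x
  simpa using LinearMap.congr_fun this a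

theorem mul_mem_coann (y : MonoidAlgebra k (Set (X × X))) {a : MonoidAlgebra k (Set (X × X))}
    (ha : a ∈ (functionals k X).dualCoannihilator) :
    y * a ∈ (functionals k X).dualCoannihilator := by
  refine forall_mem_of_forall_of (LinearMap.mulRight k a) _ (fun Q => ?_) y
  rw [mem_coann]
  intro m R ψ φ h1 h2 h3
  have := mem_coann.1 ha m R (ψ ⊚ Q) φ h1 (by rw [← rcomp_assoc, h2]) h3
  rw [← this]
  have h : lam k R ψ φ ∘ₗ LinearMap.mulLeft k (MonoidAlgebra.of k _ Q) = lam k R (ψ ⊚ Q) φ := by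
    classical
    refine linearMap_ext_of fun Q' => ?_
    rw [LinearMap.comp_apply, LinearMap.mulLeft_apply, ← map_mul, lam_of, lam_of]
    change (if ψ ⊚ (Q ⊚ Q') ⊚ φ = R then (1 : k) else 0) = _
    simp only [rcomp_assoc]
  exact LinearMap.congr_fun h a

variable (k X) in
/-- The span of the relations factoring through a set with fewer than `m` elements. -/
noncomputable def throughLT (m : ℕ) : Submodule k (MonoidAlgebra k (Set (X × X))) :=
  Submodule.span k {x | ∃ (B : Type) (_ : Fintype B) (α : Set (X × B)) (β : Set (B × X)),
    Fintype.card B < m ∧ MonoidAlgebra.of k _ (α ⊚ β) = x}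

variable (k X) in
/-- The span of the relations factoring through a relation with at least `j` elements on `Fin m`,
or through a smaller set. -/
noncomputable def throughRel (m j : ℕ) : Submodule k (MonoidAlgebra k (Set (X × X))) :=
  Submodule.span k {x | ∃ (α : Set (X × Fin m)) (U : Set (Fin m × Fin m)) (β : Set (Fin m × X)),
    j ≤ U.ncard ∧ MonoidAlgebra.of k _ (α ⊚ U ⊚ β) = x} ⊔ throughLT k X m

theorem of_mem_throughLT {m : ℕ} {B : Type} [Fintype B] (α : Set (X × B)) (β : Set (B × X))
    (h : Fintype.card B < m) : MonoidAlgebra.of k _ (α ⊚ β) ∈ throughLT k X m :=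
  Submodule.subset_span ⟨B, _, α, β, h, rfl⟩

theorem throughLT_mul_mem {m : ℕ} {x : MonoidAlgebra k (Set (X × X))} (hx : x ∈ throughLT k X m)
    (y : MonoidAlgebra k (Set (X × X))) : x * y ∈ throughLT k X m := by
  refine forall_mem_of_forall_of (LinearMap.mulLeft k x) _ (fun Q => ?_) y
  refine (Submodule.span_le (p := (throughLT k X m).comap
    (LinearMap.mulRight k (MonoidAlgebra.of k _ Q)))).2 ?_ hx
  rintro _ ⟨B, _, α, β, h, rfl⟩
  simp only [Submodule.comap_coe, Set.mem_preimage, LinearMap.mulRight_apply, SetLike.mem_coe]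
  rw [← map_mul]
  change MonoidAlgebra.of k _ (α ⊚ β ⊚ Q) ∈ _
  rw [rcomp_assoc]
  exact of_mem_throughLT _ _ h

theorem mul_throughLT_mem {m : ℕ} {x : MonoidAlgebra k (Set (X × X))} (hx : x ∈ throughLT k X m)
    (y : MonoidAlgebra k (Set (X × X))) : y * x ∈ throughLT k X m := by
  refine forall_mem_of_forall_of (LinearMap.mulRight k x) _ (fun Q => ?_) y
  refine (Submodule.span_le (p := (throughLT k X m).comap
    (LinearMap.mulLeft k (MonoidAlgebra.of k _ Q)))).2 ?_ hx
  rintro _ ⟨B, _, α, β, h, rfl⟩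
  simp only [Submodule.comap_coe, Set.mem_preimage, LinearMap.mulLeft_apply, SetLike.mem_coe]
  rw [← map_mul]
  change MonoidAlgebra.of k _ (Q ⊚ (α ⊚ β)) ∈ _
  rw [← rcomp_assoc]
  exact of_mem_throughLT _ _ h

theorem of_mem_throughRel {m j : ℕ} (α : Set (X × Fin m)) (U : Set (Fin m × Fin m))
    (β : Set (Fin m × X)) (h : j ≤ U.ncard) :
    MonoidAlgebra.of k _ (α ⊚ U ⊚ β) ∈ throughRel k X m j :=
  Submodule.mem_sup_left (Submodule.subset_span ⟨α, U, β, h, rfl⟩)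

theorem of_mem_throughLT_of_thin {m : ℕ} (α : Set (X × Fin m)) {U : Set (Fin m × Fin m)}
    (hU : Thin U) (β : Set (Fin m × X)) :
    MonoidAlgebra.of k _ (α ⊚ U ⊚ β) ∈ throughLT k X m := by
  obtain ⟨B, _, u, v, hB, rfl⟩ := hU
  rw [← rcomp_assoc, rcomp_assoc]
  exact of_mem_throughLT _ _ (by simpa using hB)

theorem of_mul_mul_of_mem {m : ℕ} (α : Set (X × Fin m)) (U : Set (Fin m × Fin m))
    (β : Set (Fin m × X)) (α' : Set (X × Fin m)) (β' : Set (Fin m × X))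
    {a : MonoidAlgebra k (Set (X × X))} (ha : a ∈ (functionals k X).dualCoannihilator) :
    MonoidAlgebra.of k _ (α ⊚ U ⊚ β) * a * MonoidAlgebra.of k _ (α' ⊚ β') ∈
      throughRel k X m (U.ncard + 1) := by
  classical
  by_cases hU : Thin U
  · exact Submodule.mem_sup_right (throughLT_mul_mem (throughLT_mul_mem
      (of_mem_throughLT_of_thin α hU β) _) _)
  have hR := isPO_residual hU
  let R := rightResidual U
  let D : MonoidAlgebra k (Set (X × X)) →ₗ[k] MonoidAlgebra k (Set (X × X)) :=
    LinearMap.mulRight k (MonoidAlgebra.of k _ (α' ⊚ β')) ∘ₗ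
      LinearMap.mulLeft k (MonoidAlgebra.of k _ (α ⊚ U ⊚ β)) -
    ∑ τ : Equiv.Perm (Fin m), (lam k R (R ⊚ β) (ract τ α' ⊚ R)).smulRight
      (MonoidAlgebra.of k _ (α ⊚ ract τ⁻¹ U ⊚ β'))
  have hD : D a = MonoidAlgebra.of k _ (α ⊚ U ⊚ β) * a * MonoidAlgebra.of k _ (α' ⊚ β') := by
    simp only [D, LinearMap.sub_apply, LinearMap.comp_apply, LinearMap.mulRight_apply,
      LinearMap.mulLeft_apply, LinearMap.sum_apply, LinearMap.smulRight_apply]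
    rw [Finset.sum_eq_zero, sub_zero]
    intro τ _
    rw [mem_coann.1 ha m R _ _ hR (by rw [← rcomp_assoc, hR.rcomp_self])
      (by rw [rcomp_assoc, hR.rcomp_self]), zero_smul]
  rw [← hD]
  refine forall_mem_of_forall_of D _ (fun Q => ?_) a
  let W := β ⊚ Q ⊚ α'
  have hmul : MonoidAlgebra.of k _ (α ⊚ U ⊚ β) * MonoidAlgebra.of k _ Q *
      MonoidAlgebra.of k _ (α' ⊚ β') = MonoidAlgebra.of k _ (α ⊚ (U ⊚ W) ⊚ β') := by
    rw [← map_mul, ← map_mul]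
    change MonoidAlgebra.of k _ (α ⊚ U ⊚ β ⊚ Q ⊚ (α' ⊚ β')) = _
    simp only [W, rcomp_assoc]
  have hlam : ∀ τ : Equiv.Perm (Fin m), lam k R (R ⊚ β) (ract τ α' ⊚ R)
      (MonoidAlgebra.of k _ Q) = if ract τ (U ⊚ W) = U then 1 else 0 := by
    intro τ
    rw [lam_of]
    have h1 : R ⊚ β ⊚ Q ⊚ (ract τ α' ⊚ R) = R ⊚ ract τ W ⊚ R := by
      simp only [W, ← rcomp_ract, rcomp_assoc]
    rw [h1]
    exact if_congr (rcomp_eq_left_iff hU (W := ract τ W)) rfl rfl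
  simp only [D, LinearMap.sub_apply, LinearMap.comp_apply, LinearMap.mulRight_apply,
    LinearMap.mulLeft_apply, LinearMap.sum_apply, LinearMap.smulRight_apply, hmul, hlam]
  by_cases hτ : ∃ τ : Equiv.Perm (Fin m), ract τ (U ⊚ W) = U
  · obtain ⟨τ, hτ⟩ := hτ
    have hUW : U ⊚ W = ract τ⁻¹ U := ract_eq_iff.1 hτ
    rw [Finset.sum_eq_single τ]
    · rw [if_pos hτ, one_smul, ← hUW, sub_self]
      exact Submodule.zero_mem _
    · intro σ _ hne
      rw [if_neg, zero_smul]
      intro hσ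
      have := (ract_eq_iff.1 hσ).symm.trans hUW
      exact hne (inv_injective (ract_inj_of_not_thin hU this))
    · simp
  · rw [Finset.sum_eq_zero, sub_zero]
    · by_cases hT : Thin (U ⊚ W)
      · exact Submodule.mem_sup_right (of_mem_throughLT_of_thin α hT β')
      · obtain ⟨σ, hσ⟩ := exists_perm_of_not_thin fun h => hT (h.rcomp_left U)
        refine of_mem_throughRel _ _ _ ?_
        have hss : U ⊂ ract σ (U ⊚ W) := by
          refine Set.ssubset_iff_subset_ne.2 ⟨?_, fun h => hτ ⟨σ, h.symm⟩⟩
          rintro ⟨z, e⟩ hz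
          exact ⟨e, hz, hσ e⟩
        have h1 := Set.ncard_lt_ncard hss
        have h2 : (ract σ (U ⊚ W)).ncard = (U ⊚ W).ncard := by
          have : ract σ (U ⊚ W) = (Equiv.prodCongr (Equiv.refl _) σ) ⁻¹' (U ⊚ W) := rfl
          rw [this]
          exact Set.ncard_preimage_of_injective_subset_range (Equiv.injective _) (by simp)
        omega
    · intro τ _
      rw [if_neg fun h => hτ ⟨τ, h⟩, zero_smul]

theorem throughLT_succ_le (m : ℕ) : throughLT k X (m + 1) ≤ throughRel k X m 0 := by
  rw [throughLT, Submodule.span_le]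
  rintro _ ⟨B, _, α, β, h, rfl⟩
  rcases Nat.lt_succ_iff_lt_or_eq.1 h with h | h
  · exact Submodule.mem_sup_right (of_mem_throughLT _ _ h)
  · let e := Fintype.equivFinOfCardEq h
    have : α ⊚ β = {p : X × Fin m | (p.1, e.symm p.2) ∈ α} ⊚ diag (Fin m) ⊚
        {p : Fin m × X | (e.symm p.1, p.2) ∈ β} := by
      rw [rcomp_diag]
      ext ⟨a, b⟩
      constructor
      · rintro ⟨y, h1, h2⟩
        exact ⟨e y, by simpa using h1, by simpa using h2⟩
      · rintro ⟨y, h1, h2⟩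
        exact ⟨e.symm y, h1, h2⟩
    rw [this]
    exact of_mem_throughRel _ _ _ (Nat.zero_le _)

theorem throughRel_mul_le (m j : ℕ) :
    throughRel k X m j * (functionals k X).dualCoannihilator * throughLT k X (m + 1) ≤
      throughRel k X m (j + 1) := by
  have anti : ∀ i, j + 1 ≤ i → throughRel k X m i ≤ throughRel k X m (j + 1) := by
    intro i hi
    refine sup_le_sup_right (Submodule.span_mono ?_) _
    rintro _ ⟨α, U, β, h, rfl⟩
    exact ⟨α, U, β, hi.trans h, rfl⟩
  rw [mul_assoc, Submodule.mul_le]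
  intro x hx y hy
  refine (Submodule.mul_le (P := (throughRel k X m (j + 1)).comap (LinearMap.mulLeft k x))).2
    ?_ hy
  intro a ha b hb
  simp only [Submodule.mem_comap, LinearMap.mulLeft_apply, ← mul_assoc]
  have hb' := throughLT_succ_le m hb
  have left : ∀ x ∈ throughLT k X m, x * a * b ∈ throughRel k X m (j + 1) := fun x hx =>
    Submodule.mem_sup_right (throughLT_mul_mem (throughLT_mul_mem hx _) _)
  refine (sup_le (Submodule.span_le.2 ?_) ?_ : _ ≤ (throughRel k X m (j + 1)).comap
    (LinearMap.mulRight k b ∘ₗ LinearMap.mulRight k a)) hx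
  · rintro _ ⟨α, U, β, h, rfl⟩
    refine (sup_le (Submodule.span_le.2 ?_) ?_ : _ ≤ (throughRel k X m (j + 1)).comap
      (LinearMap.mulLeft k (MonoidAlgebra.of k _ (α ⊚ U ⊚ β) * a))) hb'
    · rintro _ ⟨α', U', β', -, rfl⟩
      simp only [Submodule.comap_coe, Set.mem_preimage, LinearMap.mulLeft_apply, SetLike.mem_coe]
      rw [rcomp_assoc α']
      exact anti _ (by omega) (of_mul_mul_of_mem α U β α' (U' ⊚ β') ha)
    · intro b hb
      exact Submodule.mem_sup_right (mul_throughLT_mem hb _)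
  · intro x hx
    exact left x hx

theorem exists_pow_le_throughLT (m : ℕ) {N : ℕ}
    (h : (functionals k X).dualCoannihilator ^ N ≤ throughLT k X (m + 1)) :
    ∃ N', (functionals k X).dualCoannihilator ^ N' ≤ throughLT k X m := by
  have key : ∀ j, ∃ N', (functionals k X).dualCoannihilator ^ N' ≤ throughRel k X m j := by
    intro j
    induction j with
    | zero => exact ⟨N, h.trans (throughLT_succ_le m)⟩
    | succ j ih =>
      obtain ⟨N', hN'⟩ := ih
      refine ⟨N' + 1 + N, ?_⟩
      rw [pow_add, pow_succ]
      exact (mul_le_mul' (mul_le_mul' hN' le_rfl) h).trans (throughRel_mul_le m j)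
  obtain ⟨N', hN'⟩ := key (m * m + 1)
  refine ⟨N', hN'.trans (sup_le ?_ le_rfl)⟩
  rw [Submodule.span_le]
  rintro _ ⟨α, U, β, hU, rfl⟩
  have := Set.ncard_le_card U
  simp at this
  omega

theorem exists_coann_pow_eq_bot [Fintype X] :
    ∃ N, (functionals k X).dualCoannihilator ^ N = ⊥ := by
  have key : ∀ m ≤ Fintype.card X + 1, ∃ N, (functionals k X).dualCoannihilator ^ N ≤
      throughLT k X m := by
    intro m hm
    induction hm using Nat.decreasingInduction with
    | self =>
      refine ⟨1, fun x _ => ?_⟩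
      refine forall_mem_of_forall_of LinearMap.id _ (fun Q => ?_) x
      rw [LinearMap.id_apply, ← diag_rcomp Q]
      exact of_mem_throughLT _ _ (Nat.lt_succ_self _)
    | of_succ m _ ih =>
      obtain ⟨N, hN⟩ := ih
      exact exists_pow_le_throughLT m hN
  obtain ⟨N, hN⟩ := key 0 (Nat.zero_le _)
  refine ⟨N, le_bot_iff.1 (hN.trans (Submodule.span_le.2 ?_))⟩
  rintro _ ⟨B, _, α, β, hB, rfl⟩
  omega

theorem mem_jacobson_iff_mem_coann [CharZero k] [Fintype X] (a : MonoidAlgebra k (Set (X × X))) :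
    a ∈ Ideal.jacobson (⊥ : Ideal (MonoidAlgebra k (Set (X × X)))) ↔
      a ∈ (functionals k X).dualCoannihilator := by
  constructor
  · intro ha
    rw [Ideal.jacobson_bot] at ha
    rw [mem_coann]
    intro m R ψ φ h1 h2 h3
    exact lam_eq_zero_of_mem_jacobson h1 h2 h3 ha
  · intro ha
    obtain ⟨N, hN⟩ := exists_coann_pow_eq_bot (k := k) (X := X)
    rw [Ideal.mem_jacobson_iff]
    intro y
    have hnil : IsNilpotent (y * a) := ⟨N, by
      have := Submodule.pow_mem_pow _ (mul_mem_coann y ha) N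
      rwa [hN, Submodule.mem_bot] at this⟩
    obtain ⟨u, hu⟩ := hnil.isUnit_one_add
    refine ⟨↑u⁻¹, ?_⟩
    have : (↑u⁻¹ : MonoidAlgebra k (Set (X × X))) * y * a + ↑u⁻¹ - 1 =
        ↑u⁻¹ * (1 + y * a) - 1 := by noncomm_ring
    rw [this, ← hu, Units.inv_mul, sub_self]
    exact Submodule.zero_mem _

end Nilpotent

section Triangular

variable {k : Type*} [Field k] {E Z X : Type*} [Fintype E] [Fintype X]
  [DecidableEq E] [DecidableEq Z]

/-- `blockDiff w G P Q` is the product of the `G x` over the positions `x` with `w x` in `Z`, times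
the product over `e` of the differences of the products of `P e` and `Q e` over the fibre
of `w` above `e`. -/
def blockDiff (w : X → E ⊕ Z) (G : X → k) (P Q : E → X → k) : k :=
  (∏ x, Sum.elim (fun _ => 1) (fun _ => G x) (w x)) *
    ∏ e, (∏ x with w x = Sum.inl e, P e x - ∏ x with w x = Sum.inl e, Q e x)

theorem blockDiff_eq_sum (w : X → E ⊕ Z) (G : X → k) (P Q : E → X → k) :
    blockDiff w G P Q = ∑ S : Finset E, (-1) ^ S.card *
      ∏ x, Sum.elim (fun e => if e ∈ S then Q e x else P e x) (fun _ => G x) (w x) := by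
  have key : ∀ H : E → X → k, ∏ x, Sum.elim (fun e => H e x) (fun _ => G x) (w x) =
      (∏ x, Sum.elim (fun _ => 1) (fun _ => G x) (w x)) *
        ∏ e, ∏ x with w x = Sum.inl e, H e x := by
    intro H
    have : ∏ e, ∏ x with w x = Sum.inl e, H e x =
        ∏ x, Sum.elim (fun e => H e x) (fun _ => 1) (w x) := by
      simp_rw [Finset.prod_filter]
      rw [Finset.prod_comm]
      refine Finset.prod_congr rfl fun x _ => ?_
      cases w x <;> simp
    rw [this, ← Finset.prod_mul_distrib]
    refine Finset.prod_congr rfl fun x _ => ?_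
    cases w x <;> simp
  simp_rw [key fun e x => if e ∈ (_ : Finset E) then Q e x else P e x]
  rw [blockDiff]
  simp_rw [mul_left_comm _ (∏ x, Sum.elim (fun _ => (1 : k)) (fun _ => G x) (w x))]
  rw [← Finset.mul_sum]
  congr 1
  simp_rw [sub_eq_neg_add]
  rw [Finset.prod_add, ← Finset.powerset_univ]
  refine Finset.sum_congr rfl fun S _ => ?_
  rw [Finset.prod_neg, mul_assoc]
  congr 1
  rw [← Finset.prod_mul_prod_compl S (fun e => ∏ x with w x = Sum.inl e,
    if e ∈ S then Q e x else P e x), ← Finset.compl_eq_univ_sdiff]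
  congr 1
  · exact Finset.prod_congr rfl fun e he => by simp [he]
  · exact Finset.prod_congr rfl fun e he => by simp [Finset.mem_compl.1 he]

/-- The matrix attached to a kernel `C` on `E ⊕ Z`. -/
def hitMatrix (C : E ⊕ Z → E ⊕ Z → k) (w w' : X → E ⊕ Z) : k :=
  (∏ x, C (w x) (w' x)) *
    ∏ e : E, (1 - ∏ x, (1 - if w x = Sum.inl e ∧ w' x = Sum.inl e then 1 else 0))

/-- A column basis adapted to `C`. -/
def baseFun (C : E ⊕ Z → E ⊕ Z → k) : E ⊕ Z → E ⊕ Z → k :=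
  Sum.elim (fun e u => if u = Sum.inl e then 1 else 0) (fun z u => C u (Sum.inr z))

/-- The coefficients of the column of `e` in the adapted basis. -/
def baseCoeff (C : E ⊕ Z → E ⊕ Z → k) (zs : E → Z) (e : E) : E ⊕ Z → k :=
  Sum.elim (fun f => C (Sum.inl f) (Sum.inl e) - C (Sum.inl f) (Sum.inr (zs e)))
    (fun z => if z = zs e then 1 else 0)

variable {C : E ⊕ Z → E ⊕ Z → k} {zs : E → Z}

theorem sum_baseCoeff [Fintype Z]
    (hzs : ∀ e z, C (Sum.inr z) (Sum.inl e) = C (Sum.inr z) (Sum.inr (zs e)))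
    (e : E) (u : E ⊕ Z) : ∑ y, baseCoeff C zs e y * baseFun C y u = C u (Sum.inl e) := by
  rw [Fintype.sum_sum_type]
  cases u with
  | inl f => simp [baseCoeff, baseFun]
  | inr z => simp [baseCoeff, baseFun, hzs]

theorem hitMatrix_eq_blockDiff (hC : ∀ e, C (Sum.inl e) (Sum.inl e) = 1) {w w' : X → E ⊕ Z} :
    hitMatrix C w w' = blockDiff w' (fun x => C (w x) (w' x)) (fun e x => C (w x) (Sum.inl e))
      (fun e x => C (w x) (Sum.inl e) - if w x = Sum.inl e then 1 else 0) := by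
  have h1 : ∏ x, C (w x) (w' x) =
      (∏ x, Sum.elim (fun _ => 1) (fun _ => C (w x) (w' x)) (w' x)) *
        ∏ e : E, ∏ x with w' x = Sum.inl e, C (w x) (Sum.inl e) := by
    simp_rw [Finset.prod_filter]
    rw [Finset.prod_comm, ← Finset.prod_mul_distrib]
    refine Finset.prod_congr rfl fun x _ => ?_
    cases w' x <;> simp
  rw [hitMatrix, h1, blockDiff, mul_assoc, ← Finset.prod_mul_distrib]
  congr 1
  refine Finset.prod_congr rfl fun e _ => ?_
  have h2 : ∏ x, (1 - if w x = Sum.inl e ∧ w' x = Sum.inl e then (1 : k) else 0) =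
      ∏ x with w' x = Sum.inl e, (1 - if w x = Sum.inl e then (1 : k) else 0) := by
    rw [Finset.prod_filter]
    refine Finset.prod_congr rfl fun x _ => ?_
    by_cases h : w' x = Sum.inl e <;> simp [h]
  rw [mul_sub, mul_one, h2, ← Finset.prod_mul_distrib]
  congr 1
  refine Finset.prod_congr rfl fun x _ => ?_
  by_cases h : w x = Sum.inl e
  · simp [h, hC]
  · simp [h]

/-- The coefficients of a column of `hitMatrix` in the tensor basis. -/
def hitCoeff (C : E ⊕ Z → E ⊕ Z → k) (zs : E → Z) (w' y : X → E ⊕ Z) : k :=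
  blockDiff w' (fun x => if y x = w' x then 1 else 0) (fun e x => baseCoeff C zs e (y x))
    (fun e x => baseCoeff C zs e (y x) - if y x = Sum.inl e then 1 else 0)

theorem sum_hitCoeff [Fintype Z] [DecidableEq X] (hC : ∀ e, C (Sum.inl e) (Sum.inl e) = 1)
    (hzs : ∀ e z, C (Sum.inr z) (Sum.inl e) = C (Sum.inr z) (Sum.inr (zs e)))
    (w w' : X → E ⊕ Z) :
    hitMatrix C w w' = ∑ y : X → E ⊕ Z, hitCoeff C zs w' y * ∏ x, baseFun C (y x) (w x) := by
  rw [hitMatrix_eq_blockDiff hC, blockDiff_eq_sum]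
  simp_rw [hitCoeff, blockDiff_eq_sum, Finset.sum_mul]
  rw [Finset.sum_comm]
  refine Finset.sum_congr rfl fun S _ => ?_
  simp_rw [mul_assoc, ← Finset.mul_sum, ← Finset.prod_mul_distrib]
  congr 1
  rw [← Fintype.prod_sum fun x y => Sum.elim (fun e => if e ∈ S then baseCoeff C zs e y -
    (if y = Sum.inl e then 1 else 0) else baseCoeff C zs e y)
      (fun _ => if y = w' x then 1 else 0) (w' x) * baseFun C y (w x)]
  refine Finset.prod_congr rfl fun x _ => ?_
  cases h : w' x with
  | inl e =>
    by_cases he : e ∈ S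
    · simp only [Sum.elim_inl, if_pos he, sub_mul, Finset.sum_sub_distrib, sum_baseCoeff hzs]
      simp [baseFun]
    · simp only [Sum.elim_inl, if_neg he, sum_baseCoeff hzs]
  | inr z => simp [baseFun]

theorem hitCoeff_self_ne_zero (hC : ∀ e, C (Sum.inl e) (Sum.inl e) = 1)
    (h01 : ∀ e, C (Sum.inl e) (Sum.inr (zs e)) = 0 ∨ C (Sum.inl e) (Sum.inr (zs e)) = 1)
    {w : X → E ⊕ Z} (hw : ∀ e, ∃ x, w x = Sum.inl e) : hitCoeff C zs w w ≠ 0 := by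
  rw [hitCoeff, blockDiff]
  refine mul_ne_zero (Finset.prod_ne_zero_iff.2 fun x _ => by cases w x <;> simp)
    (Finset.prod_ne_zero_iff.2 fun e _ => ?_)
  have hne : (Finset.univ.filter fun x => w x = Sum.inl e).card ≠ 0 := by
    obtain ⟨x, hx⟩ := hw e
    exact Finset.card_ne_zero_of_mem (a := x) (by simpa using hx)
  have h1 : ∏ x with w x = Sum.inl e, baseCoeff C zs e (w x) =
      (1 - C (Sum.inl e) (Sum.inr (zs e))) ^
        (Finset.univ.filter fun x => w x = Sum.inl e).card := by
    refine Finset.prod_eq_pow_card fun x hx => ?_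
    simp only [Finset.mem_filter, Finset.mem_univ, true_and] at hx
    simp [hx, baseCoeff, hC]
  have h2 : ∏ x with w x = Sum.inl e, (baseCoeff C zs e (w x) -
      if w x = Sum.inl e then 1 else 0) =
      (-C (Sum.inl e) (Sum.inr (zs e))) ^ (Finset.univ.filter fun x => w x = Sum.inl e).card := by
    refine Finset.prod_eq_pow_card fun x hx => ?_
    simp only [Finset.mem_filter, Finset.mem_univ, true_and] at hx
    simp [hx, baseCoeff, hC]
  rw [h1, h2]
  rcases h01 e with h | h <;> simp [h, hne]

theorem exists_of_hitCoeff_ne_zero {w y : X → E ⊕ Z} (h : hitCoeff C zs w y ≠ 0) (e : E) :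
    ∃ x, y x = Sum.inl e := by
  by_contra! hy
  refine h (mul_eq_zero_of_right _ (Finset.prod_eq_zero (Finset.mem_univ e) ?_))
  rw [sub_eq_zero]
  exact Finset.prod_congr rfl fun x _ => by simp [hy x]

theorem sum_lt_of_forall {α : Type*} {R : α → ℕ} {w y : X → α}
    (h : ∀ x, y x = w x ∨ R (y x) < R (w x)) (hne : y ≠ w) : ∑ x, R (y x) < ∑ x, R (w x) := by
  obtain ⟨x, hx⟩ := Function.ne_iff.1 hne
  refine Finset.sum_lt_sum (fun x _ => ?_) ⟨x, Finset.mem_univ x, (h x).resolve_left hx⟩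
  rcases h x with h | h
  · rw [h]
  · exact h.le

theorem sum_lt_of_hitCoeff_ne_zero {κ : E → ℕ}
    (hκ : ∀ e f, f ≠ e → C (Sum.inl f) (Sum.inl e) ≠ C (Sum.inl f) (Sum.inr (zs e)) → κ f < κ e)
    {w y : X → E ⊕ Z} (h : hitCoeff C zs w y ≠ 0) (hne : y ≠ w) :
    ∑ x, Sum.elim (fun e => κ e + 1) (fun _ => 0) (y x) <
      ∑ x, Sum.elim (fun e => κ e + 1) (fun _ => 0) (w x) := by
  rw [hitCoeff, blockDiff_eq_sum] at h
  obtain ⟨S, -, hS⟩ := Finset.exists_ne_zero_of_sum_ne_zero h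
  have hx := fun x => Finset.prod_ne_zero_iff.1 (right_ne_zero_of_mul hS) x (Finset.mem_univ x)
  refine sum_lt_of_forall (fun x => ?_) hne
  have hx := hx x
  cases hw : w x with
  | inr z =>
    left
    rw [hw] at hx
    by_contra hc
    simp [hc] at hx
  | inl e =>
    cases hy : y x with
    | inr z => simp
    | inl f =>
      by_cases hf : f = e
      · exact Or.inl (by rw [hf])
      · right
        have := hκ e f hf
        rw [hw, hy] at hx
        simp only [Sum.elim_inl, baseCoeff, Sum.inl.injEq, hf, if_false, sub_zero, ite_self] at hx
        simpa using this (sub_ne_zero.1 hx)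

theorem eq_zero_of_sum_hitMatrix [Fintype Z] [DecidableEq X]
    (hC : ∀ e, C (Sum.inl e) (Sum.inl e) = 1)
    (hzs : ∀ e z, C (Sum.inr z) (Sum.inl e) = C (Sum.inr z) (Sum.inr (zs e)))
    (h01 : ∀ e, C (Sum.inl e) (Sum.inr (zs e)) = 0 ∨ C (Sum.inl e) (Sum.inr (zs e)) = 1)
    {κ : E → ℕ}
    (hκ : ∀ e f, f ≠ e → C (Sum.inl f) (Sum.inl e) ≠ C (Sum.inl f) (Sum.inr (zs e)) → κ f < κ e)
    (hZ : ∀ z, C (Sum.inr z) (Sum.inr z) = 1) {ht : Z → ℕ}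
    (hht : ∀ z z', C (Sum.inr z') (Sum.inr z) ≠ 0 → z' = z ∨ ht z' < ht z)
    {v : (X → E ⊕ Z) → k} (hv : ∀ w, (¬ ∀ e, ∃ x, w x = Sum.inl e) → v w = 0)
    (h : ∀ w', (∀ e, ∃ x, w' x = Sum.inl e) → ∑ w, v w * hitMatrix C w w' = 0) : v = 0 := by
  have step : ∀ n, ∀ y : X → E ⊕ Z, ∑ x, Sum.elim (fun e => κ e + 1) (fun _ => 0) (y x) = n →
      (∀ e, ∃ x, y x = Sum.inl e) → ∑ w, v w * ∏ x, baseFun C (y x) (w x) = 0 := by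
    intro n
    induction n using Nat.strong_induction_on with
    | _ n ih =>
      intro w' hn hw'
      have h0 := h w' hw'
      simp_rw [sum_hitCoeff hC hzs, Finset.mul_sum, mul_left_comm (v _)] at h0
      rw [Finset.sum_comm] at h0
      simp_rw [← Finset.mul_sum] at h0
      rw [Finset.sum_eq_single w'] at h0
      · exact (mul_eq_zero.1 h0).resolve_left (hitCoeff_self_ne_zero hC h01 hw')
      · intro y _ hne
        by_cases hc : hitCoeff C zs w' y = 0
        · rw [hc, zero_mul]
        · rw [ih _ (hn ▸ sum_lt_of_hitCoeff_ne_zero hκ hc hne) y rfl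
            (exists_of_hitCoeff_ne_zero hc), mul_zero]
      · simp
  have key : ∀ n, ∀ y : X → E ⊕ Z, ∑ x, Sum.elim (fun _ => 0) (fun z => ht z + 1) (y x) = n →
      v y = 0 := by
    intro n
    induction n using Nat.strong_induction_on with
    | _ n ih =>
      intro y hn
      by_cases hy : ∀ e, ∃ x, y x = Sum.inl e
      · have h0 := step _ y rfl hy
        rw [Finset.sum_eq_single y] at h0
        · rw [Finset.prod_eq_one, mul_one] at h0
          · exact h0
          · intro x _
            cases y x <;> simp [baseFun, hZ]
        · intro w _ hne
          by_cases hp : ∏ x, baseFun C (y x) (w x) = 0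
          · rw [hp, mul_zero]
          · rw [ih _ (hn ▸ sum_lt_of_forall (fun x => ?_) hne) w rfl, zero_mul]
            have hx := Finset.prod_ne_zero_iff.1 hp x (Finset.mem_univ x)
            cases hyx : y x with
            | inl e =>
              left
              by_contra hc
              simp [baseFun, hyx, hc] at hx
            | inr z =>
              cases hwx : w x with
              | inl e => simp
              | inr z' =>
                rw [hyx, hwx] at hx
                rcases hht z z' hx with h | h
                · exact Or.inl (by rw [h])
                · right
                  simpa using h
        · simp
      · exact hv y hy
  funext y
  exact key _ y rfl

end Triangular

section Saturated

variable {α β γ E X : Type}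

/-- The transpose of a relation. -/
def transp (S : Set (α × β)) : Set (β × α) := {p | (p.2, p.1) ∈ S}

/-- The row of a relation at a point. -/
def row (S : Set (α × β)) (a : α) : Set β := {b | (a, b) ∈ S}

theorem mem_row {S : Set (α × β)} {a : α} {b : β} : b ∈ row S a ↔ (a, b) ∈ S := Iff.rfl

theorem mem_transp {S : Set (α × β)} {a : α} {b : β} : (b, a) ∈ transp S ↔ (a, b) ∈ S := Iff.rfl

theorem transp_transp (S : Set (α × β)) : transp (transp S) = S := rfl

theorem transp_injective : Function.Injective (transp : Set (α × β) → Set (β × α)) :=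
  fun S T h => by rw [← transp_transp S, h, transp_transp]

theorem transp_rcomp (S : Set (α × β)) (T : Set (β × γ)) :
    transp (S ⊚ T) = transp T ⊚ transp S := by
  ext ⟨a, b⟩
  exact ⟨fun ⟨y, h1, h2⟩ => ⟨y, h2, h1⟩, fun ⟨y, h1, h2⟩ => ⟨y, h2, h1⟩⟩

theorem IsPO.isPO_transp {R : Set (E × E)} (h : IsPO R) : IsPO (transp R) :=
  ⟨h.refl, fun h1 h2 => h.trans h2 h1, fun h1 h2 => h.antisymm h2 h1⟩

theorem eq_of_row_eq {S T : Set (α × β)} (h : ∀ a, row S a = row T a) : S = T := by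
  ext ⟨a, b⟩
  exact Set.ext_iff.1 (h a) b

theorem IsPO.row_injective {R : Set (E × E)} (h : IsPO R) : Function.Injective (row R) := by
  intro a b hab
  refine h.antisymm ?_ ?_
  · have : b ∈ row R b := h.refl b
    rwa [← hab] at this
  · have : a ∈ row R a := h.refl a
    rwa [hab] at this

/-- Upward closed sets. -/
def IsUp (R : Set (E × E)) (t : Set E) : Prop := ∀ a b, a ∈ t → (a, b) ∈ R → b ∈ t

/-- Upward closed sets which are not principal. -/
def NonPrin (R : Set (E × E)) (t : Set E) : Prop := IsUp R t ∧ ∀ e, t ≠ row R e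

/-- Every element of `s` lies below every element of `t`. -/
def Below (R : Set (E × E)) (s t : Set E) : Prop := ∀ a ∈ s, ∀ b ∈ t, (a, b) ∈ R

/-- Pairs of non principal sets, the first below the second, maximal for this property. -/
structure ClosedPair (R : Set (E × E)) (s t : Set E) : Prop where
  left : NonPrin (transp R) s
  right : NonPrin R t
  below : Below R s t
  maxLeft : ∀ s', NonPrin (transp R) s' → Below R s' t → s' ⊆ s
  maxRight : ∀ t', NonPrin R t' → Below R s t' → t' ⊆ t

theorem below_transp {R : Set (E × E)} {s t : Set E} : Below (transp R) t s ↔ Below R s t :=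
  ⟨fun h a ha b hb => h b hb a ha, fun h a ha b hb => h b hb a ha⟩

theorem ClosedPair.closedPair_transp {R : Set (E × E)} {s t : Set E} (h : ClosedPair R s t) :
    ClosedPair (transp R) t s where
  left := h.right
  right := h.left
  below := below_transp.2 h.below
  maxLeft t' h1 h2 := h.maxRight t' h1 (below_transp.1 h2)
  maxRight t' h1 h2 := h.maxLeft t' h1 (below_transp.1 h2)

/-- The type of closed pairs. -/
def Pairs (R : Set (E × E)) : Type := {p : Set E × Set E // ClosedPair R p.1 p.2}

noncomputable instance [Finite E] (R : Set (E × E)) : Fintype (Pairs R) :=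
  @Fintype.ofFinite _ (inferInstanceAs (Finite {p : Set E × Set E // ClosedPair R p.1 p.2}))

/-- The lower set attached to a point or a closed pair. -/
def lowerOf (R : Set (E × E)) : E ⊕ Pairs R → Set E :=
  Sum.elim (row (transp R)) fun p => p.1.1

/-- The upper set attached to a point or a closed pair. -/
def upperOf (R : Set (E × E)) : E ⊕ Pairs R → Set E :=
  Sum.elim (row R) fun p => p.1.2

variable {R : Set (E × E)}

theorem IsPO.isUp_row (h : IsPO R) (e : E) : IsUp R (row R e) := fun _ _ h1 h2 => h.trans h1 h2

theorem IsPO.isUp_upperOf (h : IsPO R) (u : E ⊕ Pairs R) : IsUp R (upperOf R u) := by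
  cases u with
  | inl e => exact h.isUp_row e
  | inr p => exact p.2.right.1

theorem IsPO.isUp_lowerOf (h : IsPO R) (u : E ⊕ Pairs R) : IsUp (transp R) (lowerOf R u) := by
  cases u with
  | inl e => exact h.isPO_transp.isUp_row e
  | inr p => exact p.2.left.1

theorem IsPO.upperOf_injective (h : IsPO R) : Function.Injective (upperOf R) := by
  rintro (e | p) (f | q) hpq
  · rw [h.row_injective hpq]
  · exact absurd hpq.symm (q.2.right.2 e)
  · exact absurd hpq (p.2.right.2 f)
  · change p.1.2 = q.1.2 at hpq
    congr 1
    refine Subtype.ext (Prod.ext (Set.Subset.antisymm ?_ ?_) hpq)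
    · exact q.2.maxLeft _ p.2.left (hpq ▸ p.2.below)
    · exact p.2.maxLeft _ q.2.left (hpq ▸ q.2.below)

theorem IsPO.lowerOf_injective (h : IsPO R) : Function.Injective (lowerOf R) := by
  rintro (e | p) (f | q) hpq
  · rw [h.isPO_transp.row_injective hpq]
  · exact absurd hpq.symm (q.2.left.2 e)
  · exact absurd hpq (p.2.left.2 f)
  · change p.1.1 = q.1.1 at hpq
    congr 1
    refine Subtype.ext (Prod.ext hpq (Set.Subset.antisymm ?_ ?_))
    · exact q.2.maxRight _ p.2.right (hpq ▸ p.2.below)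
    · exact p.2.maxRight _ q.2.right (hpq ▸ q.2.below)

theorem IsPO.rcomp_eq_iff (h : IsPO R) {φ : Set (X × E)} :
    φ ⊚ R = φ ↔ ∀ x, IsUp R (row φ x) := by
  constructor
  · intro hφ x a b ha hab
    rw [← hφ]
    exact ⟨a, ha, hab⟩
  · intro hφ
    ext ⟨x, e⟩
    exact ⟨fun ⟨a, ha, hab⟩ => hφ x a e ha hab, fun he => ⟨e, he, h.refl e⟩⟩

theorem IsPO.rcomp_eq_iff' (h : IsPO R) {ψ : Set (E × X)} :
    R ⊚ ψ = ψ ↔ ∀ x, IsUp (transp R) (row (transp ψ) x) := by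
  rw [← h.isPO_transp.rcomp_eq_iff, ← transp_rcomp, transp_injective.eq_iff]

theorem IsPO.factor_iff_rows (h : IsPO R) {ψ : Set (E × X)} {φ : Set (X × E)} (hψ : R ⊚ ψ = ψ)
    (hφ : φ ⊚ R = φ) : ψ ⊚ φ = R ↔ (∀ x, Below R (row (transp ψ) x) (row φ x)) ∧
      ∀ e, ∃ x, row (transp ψ) x = row (transp R) e ∧ row φ x = row R e := by
  rw [h.rcomp_eq_iff] at hφ
  rw [h.rcomp_eq_iff'] at hψ
  constructor
  · intro hc
    have hb : ∀ x, Below R (row (transp ψ) x) (row φ x) := by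
      intro x a ha b hb
      rw [← hc]
      exact ⟨x, ha, hb⟩
    refine ⟨hb, fun e => ?_⟩
    have := h.refl e
    rw [← hc] at this
    obtain ⟨x, h1, h2⟩ := this
    exact ⟨x, Set.Subset.antisymm (fun a ha => hb x a ha e h2) (fun a ha => hψ x e a h1 ha),
      Set.Subset.antisymm (fun a ha => hb x e h1 a ha) (fun a ha => hφ x e a h2 ha)⟩
  · rintro ⟨h1, h2⟩
    ext ⟨a, b⟩
    constructor
    · rintro ⟨x, ha, hb⟩
      exact h1 x a ha b hb
    · intro hab
      obtain ⟨x, h3, h4⟩ := h2 a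
      refine ⟨x, ?_, ?_⟩
      · have : a ∈ row (transp ψ) x := by rw [h3]; exact h.refl a
        exact this
      · have : b ∈ row φ x := by rw [h4]; exact hab
        exact this

/-- The relations all of whose rows are principal or part of a closed pair, every principal set
being attained. -/
def Phi (R : Set (E × E)) (X : Type) : Set (Set (X × E)) :=
  {φ | (∀ x, row φ x ∈ Set.range (upperOf R)) ∧ ∀ e, ∃ x, row φ x = row R e}

/-- The transposed version of `Phi`. -/
def Psi (R : Set (E × E)) (X : Type) : Set (Set (E × X)) := {ψ | transp ψ ∈ Phi (transp R) X}

theorem range_upperOf_transp : Set.range (upperOf (transp R)) = Set.range (lowerOf R) := by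
  ext s
  constructor
  · rintro ⟨e | p, rfl⟩
    · exact ⟨Sum.inl e, rfl⟩
    · exact ⟨Sum.inr ⟨p.1.swap, p.2.closedPair_transp⟩, rfl⟩
  · rintro ⟨e | p, rfl⟩
    · exact ⟨Sum.inl e, rfl⟩
    · exact ⟨Sum.inr ⟨p.1.swap, p.2.closedPair_transp⟩, rfl⟩

theorem IsPO.rcomp_of_mem_Phi (h : IsPO R) {φ : Set (X × E)} (hφ : φ ∈ Phi R X) : φ ⊚ R = φ := by
  rw [h.rcomp_eq_iff]
  intro x
  obtain ⟨u, hu⟩ := hφ.1 x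
  rw [← hu]
  exact h.isUp_upperOf u

theorem IsPO.rcomp_of_mem_Psi (h : IsPO R) {ψ : Set (E × X)} (hψ : ψ ∈ Psi R X) :
    R ⊚ ψ = ψ := by
  have := h.isPO_transp.rcomp_of_mem_Phi hψ
  rwa [← transp_rcomp, transp_injective.eq_iff] at this

/-- The words meeting every point of `E`. -/
def OntoWord (R : Set (E × E)) (X : Type) : Type :=
  {w : X → E ⊕ Pairs R // ∀ e, ∃ x, w x = Sum.inl e}

noncomputable instance [Finite E] [Finite X] : Fintype (OntoWord R X) :=
  @Fintype.ofFinite _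
    (inferInstanceAs (Finite {w : X → E ⊕ Pairs R // ∀ e, ∃ x, w x = Sum.inl e}))

/-- The relation with prescribed rows. -/
def phiOf (R : Set (E × E)) (w : X → E ⊕ Pairs R) : Set (X × E) := {p | p.2 ∈ upperOf R (w p.1)}

/-- The relation with prescribed columns. -/
def psiOf (R : Set (E × E)) (w : X → E ⊕ Pairs R) : Set (E × X) := {p | p.1 ∈ lowerOf R (w p.2)}

theorem row_phiOf (w : X → E ⊕ Pairs R) (x : X) : row (phiOf R w) x = upperOf R (w x) := rfl

theorem row_psiOf (w : X → E ⊕ Pairs R) (x : X) :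
    row (transp (psiOf R w)) x = lowerOf R (w x) := rfl

theorem IsPO.phiOf_injective (h : IsPO R) :
    Function.Injective (phiOf R : (X → E ⊕ Pairs R) → Set (X × E)) := by
  intro w w' hw
  funext x
  apply h.upperOf_injective
  rw [← row_phiOf, hw, row_phiOf]

theorem IsPO.psiOf_injective (h : IsPO R) :
    Function.Injective (psiOf R : (X → E ⊕ Pairs R) → Set (E × X)) := by
  intro w w' hw
  funext x
  apply h.lowerOf_injective
  rw [← row_psiOf, hw, row_psiOf]

theorem IsPO.range_phiOf (h : IsPO R) :
    Set.range (fun w : OntoWord R X => phiOf R w.1) = Phi R X := by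
  ext φ
  constructor
  · rintro ⟨w, rfl⟩
    refine ⟨fun x => ⟨w.1 x, rfl⟩, fun e => ?_⟩
    obtain ⟨x, hx⟩ := w.2 e
    refine ⟨x, ?_⟩
    rw [row_phiOf, hx]
    rfl
  · rintro ⟨h1, h2⟩
    choose w hw using h1
    refine ⟨⟨w, fun e => ?_⟩, eq_of_row_eq hw⟩
    obtain ⟨x, hx⟩ := h2 e
    exact ⟨x, h.upperOf_injective ((hw x).trans hx)⟩

theorem IsPO.range_psiOf (h : IsPO R) :
    Set.range (fun w : OntoWord R X => psiOf R w.1) = Psi R X := by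
  ext ψ
  constructor
  · rintro ⟨w, rfl⟩
    refine ⟨fun x => ?_, fun e => ?_⟩
    · rw [range_upperOf_transp]
      exact ⟨w.1 x, rfl⟩
    · obtain ⟨x, hx⟩ := w.2 e
      refine ⟨x, ?_⟩
      rw [row_psiOf, hx]
      rfl
  · rintro ⟨h1, h2⟩
    rw [range_upperOf_transp] at h1
    choose w hw using h1
    refine ⟨⟨w, fun e => ?_⟩, transp_injective (eq_of_row_eq hw)⟩
    obtain ⟨x, hx⟩ := h2 e
    exact ⟨x, h.lowerOf_injective ((hw x).trans hx)⟩

theorem IsPO.phiOf_mem (h : IsPO R) (w : OntoWord R X) : phiOf R w.1 ∈ Phi R X :=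
  h.range_phiOf ▸ ⟨w, rfl⟩

theorem IsPO.psiOf_mem (h : IsPO R) (w : OntoWord R X) : psiOf R w.1 ∈ Psi R X :=
  h.range_psiOf ▸ ⟨w, rfl⟩

theorem IsPO.ncard_Phi (h : IsPO R) : (Phi R X).ncard = Nat.card (OntoWord R X) := by
  rw [← h.range_phiOf, ← Set.image_univ, Set.ncard_image_of_injective, Set.ncard_univ]
  exact fun w w' hw => Subtype.ext (h.phiOf_injective hw)

theorem IsPO.ncard_Psi (h : IsPO R) : (Psi R X).ncard = Nat.card (OntoWord R X) := by
  rw [← h.range_psiOf, ← Set.image_univ, Set.ncard_image_of_injective, Set.ncard_univ]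
  exact fun w w' hw => Subtype.ext (h.psiOf_injective hw)

end Saturated

section Good

variable (k : Type*) [Field k] {E X : Type}

open Classical in
/-- The pairing `[ψ φ = R]`. -/
noncomputable def pairing (R : Set (E × E)) (ψ : Set (E × X)) (φ : Set (X × E)) : k :=
  if ψ ⊚ φ = R then 1 else 0

noncomputable instance {α β : Type} [Finite α] [Finite β] : Fintype (Set (α × β)) :=
  Fintype.ofFinite _

/-- The families `Phi R X` and `Psi R X` are dual spanning families of saturated relations. -/
structure Good (X : Type) [Finite E] [Finite X] (R : Set (E × E)) : Prop where
  spanPhi : ∀ φ : Set (X × E), φ ⊚ R = φ → ∃ b : Set (X × E) → k, (∀ φ' ∉ Phi R X, b φ' = 0) ∧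
    ∀ ψ, R ⊚ ψ = ψ → pairing k R ψ φ = ∑ φ', b φ' * pairing k R ψ φ'
  spanPsi : ∀ ψ : Set (E × X), R ⊚ ψ = ψ → ∃ b : Set (E × X) → k, (∀ ψ' ∉ Psi R X, b ψ' = 0) ∧
    ∀ φ, φ ⊚ R = φ → pairing k R ψ φ = ∑ ψ', b ψ' * pairing k R ψ' φ
  nondegPhi : ∀ b : Set (X × E) → k, (∀ φ ∉ Phi R X, b φ = 0) →
    (∀ ψ ∈ Psi R X, ∑ φ, b φ * pairing k R ψ φ = 0) → b = 0
  nondegPsi : ∀ b : Set (E × X) → k, (∀ ψ ∉ Psi R X, b ψ = 0) →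
    (∀ φ ∈ Phi R X, ∑ ψ, b ψ * pairing k R ψ φ = 0) → b = 0

variable {k}

theorem sum_eq_sum_of_support {A I : Type*} [Fintype A] [Fintype I] {f : I → A}
    (hf : Function.Injective f) {b : A → k} (hb : ∀ a ∉ Set.range f, b a = 0) (F : A → k) :
    ∑ a, b a * F a = ∑ i, b (f i) * F (f i) := by
  classical
  rw [← Finset.sum_image (s := Finset.univ) (f := fun a => b a * F a) (fun i _ j _ h => hf h)]
  refine (Finset.sum_subset (Finset.subset_univ _) fun a _ ha => ?_).symm
  rw [hb a (by simpa using ha), zero_mul]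

variable (k) in
/-- The square matrix of the pairing. -/
noncomputable def pairMat (R : Set (E × E)) (X : Type) : Matrix (OntoWord R X) (OntoWord R X) k :=
  Matrix.of fun w w' => pairing k R (psiOf R w.1) (phiOf R w'.1)

theorem good_of_regular [Finite E] [Finite X] {R : Set (E × E)} (hR : IsPO R)
    (hreg : ∀ v : OntoWord R X → k, Matrix.vecMul v (pairMat k R X) = 0 → v = 0)
    (hcol : ∀ ψ : Set (E × X), R ⊚ ψ = ψ → ∃ c : OntoWord R X → k, ∀ φ, φ ⊚ R = φ →
      pairing k R ψ φ = ∑ w, c w * pairing k R (psiOf R w.1) φ) :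
    Good k X R := by
  classical
  have hphi : Function.Injective fun w : OntoWord R X => phiOf R w.1 :=
    fun w w' hw => Subtype.ext (hR.phiOf_injective hw)
  have hpsi : Function.Injective fun w : OntoWord R X => psiOf R w.1 :=
    fun w w' hw => Subtype.ext (hR.psiOf_injective hw)
  have hunit : IsUnit (pairMat k R X) := by
    rw [← Matrix.vecMul_injective_iff_isUnit]
    intro v v' h
    have := hreg (v - v') (by rw [Matrix.sub_vecMul]; exact sub_eq_zero.2 h)
    exact sub_eq_zero.1 this
  constructor
  · intro φ hφ
    obtain ⟨b, hb⟩ := (Matrix.mulVec_surjective_iff_isUnit.2 hunit)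
      fun w => pairing k R (psiOf R w.1) φ
    refine ⟨Function.extend (fun w : OntoWord R X => phiOf R w.1) b 0, fun φ' hφ' => ?_,
      fun ψ hψ => ?_⟩
    · rw [Function.extend_apply', Pi.zero_apply]
      rwa [← hR.range_phiOf] at hφ'
    · rw [sum_eq_sum_of_support hphi]
      · obtain ⟨c, hc⟩ := hcol ψ hψ
        have hb' : ∀ w : OntoWord R X, pairing k R (psiOf R w.1) φ =
            ∑ w' : OntoWord R X, pairing k R (psiOf R w.1) (phiOf R w'.1) * b w' :=
          fun w => (congrFun hb w).symm
        have hc' : ∀ w' : OntoWord R X, pairing k R ψ (phiOf R w'.1) = _ :=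
          fun w' => hc _ (hR.rcomp_of_mem_Phi (hR.phiOf_mem w'))
        simp only [hphi.extend_apply]
        rw [hc φ hφ]
        simp only [hb', hc', Finset.mul_sum]
        rw [Finset.sum_comm]
        exact Finset.sum_congr rfl fun w' _ => Finset.sum_congr rfl fun w _ => by ring
      · intro a ha
        rw [Function.extend_apply', Pi.zero_apply]
        exact ha
  · intro ψ hψ
    obtain ⟨c, hc⟩ := hcol ψ hψ
    refine ⟨Function.extend (fun w : OntoWord R X => psiOf R w.1) c 0, fun ψ' hψ' => ?_,
      fun φ hφ => ?_⟩
    · rw [Function.extend_apply', Pi.zero_apply]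
      rwa [← hR.range_psiOf] at hψ'
    · rw [hc φ hφ, sum_eq_sum_of_support hpsi]
      · simp only [hpsi.extend_apply]
      · intro a ha
        rw [Function.extend_apply', Pi.zero_apply]
        exact ha
  · intro b hb h
    have h1 : Matrix.mulVec (pairMat k R X) (fun w => b (phiOf R w.1)) = 0 := by
      funext w
      have := h _ (hR.psiOf_mem w)
      rw [sum_eq_sum_of_support hphi (by rwa [hR.range_phiOf])] at this
      simpa [Matrix.mulVec, dotProduct, pairMat, mul_comm] using this
    have h2 := Matrix.mulVec_injective_iff_isUnit.2 hunit (h1.trans (Matrix.mulVec_zero _).symm)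
    funext φ
    by_cases hφ : φ ∈ Phi R X
    · rw [← hR.range_phiOf] at hφ
      obtain ⟨w, rfl⟩ := hφ
      exact congrFun h2 w
    · exact hb φ hφ
  · intro b hb h
    have h1 : Matrix.vecMul (fun w => b (psiOf R w.1)) (pairMat k R X) = 0 := by
      funext w
      have := h _ (hR.phiOf_mem w)
      rw [sum_eq_sum_of_support hpsi (by rwa [hR.range_psiOf])] at this
      simpa [Matrix.vecMul, dotProduct, pairMat] using this
    have h2 := hreg _ h1
    funext ψ
    by_cases hψ : ψ ∈ Psi R X
    · rw [← hR.range_psiOf] at hψ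
      obtain ⟨w, rfl⟩ := hψ
      exact congrFun h2 w
    · exact hb ψ hψ

end Good

section Certificate

variable {E X : Type} {R : Set (E × E)}

/-- A combinatorial condition on an order which ensures that `Phi` and `Psi` are dual. -/
structure Cert (R : Set (E × E)) : Prop where
  reduce : ∀ s, NonPrin (transp R) s →
    (∃ z : Pairs R, ∀ t, IsUp R t → (Below R s t ↔ Below R z.1.1 t)) ∨
    ∃ (e : E) (z : Pairs R), ∀ t, IsUp R t → (Below R s t ↔ Below R (row (transp R) e) t) ∧
      (Below R z.1.1 t ↔ Below R (row (transp R) e) t ∧ t ≠ row R e)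
  triangular : ∃ κ : E → ℕ, ∀ e, ∃ z : Pairs R,
    (∀ y : Pairs R, Below R y.1.1 (row R e) ↔ Below R y.1.1 z.1.2) ∧
    ∀ f, f ≠ e → ¬ ((f, e) ∈ R ↔ Below R (row (transp R) f) z.1.2) → κ f < κ e

theorem IsPO.below_row_row (h : IsPO R) {f e : E} :
    Below R (row (transp R) f) (row R e) ↔ (f, e) ∈ R :=
  ⟨fun hb => hb f (h.refl f) e (h.refl e), fun hfe _ ha _ hb => h.trans (h.trans ha hfe) hb⟩

/-- The relation with prescribed columns. -/
def colRel (s : X → Set E) : Set (E × X) := {p | p.1 ∈ s p.2}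

/-- Rowwise form of the equality `ψ φ = R`. -/
def Hits (R : Set (E × E)) (s t : X → Set E) : Prop :=
  (∀ x, Below R (s x) (t x)) ∧ ∀ e, ∃ x, s x = row (transp R) e ∧ t x = row R e

open Classical in
theorem IsPO.pairing_colRel (k : Type*) [Field k] (h : IsPO R) {s : X → Set E}
    (hs : ∀ x, IsUp (transp R) (s x)) {φ : Set (X × E)} (hφ : φ ⊚ R = φ) :
    pairing k R (colRel s) φ = if Hits R s (row φ) then 1 else 0 := by
  have := h.factor_iff_rows (h.rcomp_eq_iff'.2 hs : R ⊚ colRel s = colRel s) hφ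
  simp only [pairing]
  exact if_congr this rfl rfl

open Classical in
theorem hits_update_iff {s t : X → Set E} {x : X} (hx : NonPrin (transp R) (s x))
    {s' : Set E} (hs' : NonPrin (transp R) s') (hb : Below R (s x) (t x) ↔ Below R s' (t x)) :
    Hits R s t ↔ Hits R (Function.update s x s') t := by
  refine and_congr (forall_congr' fun y => ?_)
    (forall_congr' fun e => exists_congr fun y => and_congr_left fun _ => ?_)
  · rcases eq_or_ne y x with rfl | hy
    · rw [Function.update_self, hb]
    · rw [Function.update_of_ne hy]
  · rcases eq_or_ne y x with rfl | hy
    · rw [Function.update_self]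
      exact iff_of_false (hx.2 e) (hs'.2 e)
    · rw [Function.update_of_ne hy]

open Classical in
/-- Move the point `e` to the position `x`, all other occurrences being replaced. -/
noncomputable def shift (R : Set (E × E)) (s : X → Set E) (x : X) (e : E) (z : Set E) :
    X → Set E :=
  fun y => if y = x then row (transp R) e else if s y = row (transp R) e then z else s y

section Shift

variable {s t : X → Set E} {x : X} {e : E} {z : Pairs R}

open Classical in
theorem hits_update_row (hR : IsPO R) (ht : ∀ y, IsUp R (t y)) (hx : NonPrin (transp R) (s x))
    (hz : ∀ t, IsUp R t → (Below R (s x) t ↔ Below R (row (transp R) e) t) ∧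
      (Below R z.1.1 t ↔ Below R (row (transp R) e) t ∧ t ≠ row R e)) :
    Hits R (Function.update s x (row (transp R) e)) t ↔
      Hits R s t ∨ Hits R (shift R s x e z.1.1) t := by
  have hne : ∀ f, z.1.1 ≠ row (transp R) f := z.2.left.2
  have hinj := hR.isPO_transp.row_injective
  constructor
  · rintro ⟨h1, h2⟩
    have h1' : ∀ y, y ≠ x → Below R (s y) (t y) := fun y hy => by
      have := h1 y
      rwa [Function.update_of_ne hy] at this
    have h2' : ∀ f, f ≠ e → ∃ y, y ≠ x ∧ s y = row (transp R) f ∧ t y = row R f := by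
      intro f hf
      obtain ⟨y, hy1, hy2⟩ := h2 f
      have hyx : y ≠ x := by
        rintro rfl
        rw [Function.update_self] at hy1
        exact hf (hinj hy1).symm
      exact ⟨y, hyx, by rwa [Function.update_of_ne hyx] at hy1, hy2⟩
    have hxb : Below R (row (transp R) e) (t x) := by
      have := h1 x
      rwa [Function.update_self] at this
    by_cases hex : ∃ y, y ≠ x ∧ s y = row (transp R) e ∧ t y = row R e
    · left
      refine ⟨fun y => ?_, fun f => ?_⟩
      · rcases eq_or_ne y x with rfl | hy
        · exact (hz _ (ht y)).1.2 hxb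
        · exact h1' y hy
      · rcases eq_or_ne f e with rfl | hf
        · exact hex.imp fun y hy => hy.2
        · exact (h2' f hf).imp fun y hy => hy.2
    · right
      refine ⟨fun y => ?_, fun f => ?_⟩
      · rcases eq_or_ne y x with rfl | hy
        · simpa [shift] using hxb
        · by_cases hye : s y = row (transp R) e
          · simp only [shift, if_neg hy, if_pos hye]
            refine (hz _ (ht y)).2.2 ⟨hye ▸ h1' y hy, fun h => hex ⟨y, hy, hye, h⟩⟩
          · simpa only [shift, if_neg hy, if_neg hye] using h1' y hy
      · rcases eq_or_ne f e with rfl | hf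
        · refine ⟨x, by simp [shift], ?_⟩
          obtain ⟨y, hy1, hy2⟩ := h2 f
          rcases eq_or_ne y x with rfl | hy
          · exact hy2
          · rw [Function.update_of_ne hy] at hy1
            exact absurd ⟨y, hy, hy1, hy2⟩ hex
        · obtain ⟨y, hy, hy1, hy2⟩ := h2' f hf
          refine ⟨y, ?_, hy2⟩
          have : s y ≠ row (transp R) e := fun h => hf (hinj (hy1.symm.trans h))
          simpa only [shift, if_neg hy, if_neg this] using hy1
  · rintro (⟨h1, h2⟩ | ⟨h1, h2⟩)
    · refine ⟨fun y => ?_, fun f => ?_⟩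
      · rcases eq_or_ne y x with rfl | hy
        · rw [Function.update_self]
          exact (hz _ (ht y)).1.1 (h1 y)
        · rw [Function.update_of_ne hy]
          exact h1 y
      · obtain ⟨y, hy1, hy2⟩ := h2 f
        have hyx : y ≠ x := by
          rintro rfl
          exact hx.2 f hy1
        exact ⟨y, by rwa [Function.update_of_ne hyx], hy2⟩
    · refine ⟨fun y => ?_, fun f => ?_⟩
      · have hy1 := h1 y
        rcases eq_or_ne y x with rfl | hy
        · rw [Function.update_self]
          simpa [shift] using hy1
        · rw [Function.update_of_ne hy]
          by_cases hye : s y = row (transp R) e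
          · simp only [shift, if_neg hy, if_pos hye] at hy1
            rw [hye]
            exact ((hz _ (ht y)).2.1 hy1).1
          · simpa only [shift, if_neg hy, if_neg hye] using hy1
      · obtain ⟨y, hy1, hy2⟩ := h2 f
        refine ⟨y, ?_, hy2⟩
        rcases eq_or_ne y x with rfl | hy
        · rw [Function.update_self]
          simpa [shift] using hy1
        · rw [Function.update_of_ne hy]
          by_cases hye : s y = row (transp R) e
          · simp only [shift, if_neg hy, if_pos hye] at hy1
            exact absurd hy1 (hne f)
          · simpa only [shift, if_neg hy, if_neg hye] using hy1

theorem not_hits_shift (ht : ∀ y, IsUp R (t y)) (hx : NonPrin (transp R) (s x))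
    (hz : ∀ t, IsUp R t → (Below R (s x) t ↔ Below R (row (transp R) e) t) ∧
      (Below R z.1.1 t ↔ Below R (row (transp R) e) t ∧ t ≠ row R e)) (h : Hits R s t) :
    ¬ Hits R (shift R s x e z.1.1) t := by
  rintro ⟨h1, -⟩
  obtain ⟨y, hy1, hy2⟩ := h.2 e
  have hyx : y ≠ x := by
    rintro rfl
    exact hx.2 e hy1
  have := h1 y
  simp only [shift, if_neg hyx, if_pos hy1] at this
  exact ((hz _ (ht y)).2.1 this).2 hy2

end Shift


/-- The number of columns which are neither principal nor part of a closed pair. -/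
noncomputable def badness (R : Set (E × E)) (s : X → Set E) : ℕ :=
  {x | s x ∉ Set.range (lowerOf R)}.ncard

theorem badness_lt [Finite X] {s s' : X → Set E} {x : X} (hx : s x ∉ Set.range (lowerOf R))
    (hx' : s' x ∈ Set.range (lowerOf R))
    (h : ∀ y, s y ∈ Set.range (lowerOf R) → s' y ∈ Set.range (lowerOf R)) :
    badness R s' < badness R s := by
  refine Set.ncard_lt_ncard ⟨fun y hy hy' => hy (h y hy'), fun hs => ?_⟩ (Set.toFinite _)
  exact hs hx hx'

open Classical in
theorem Cert.exists_coeff [Finite E] [Finite X] (k : Type*) [Field k] (hR : IsPO R)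
    (hc : Cert R) (s : X → Set E)
    (hs : ∀ x, IsUp (transp R) (s x)) :
    ∃ c : OntoWord R X → k, ∀ t : X → Set E, (∀ x, IsUp R (t x)) →
      (if Hits R s t then (1 : k) else 0) =
        ∑ w, c w * if Hits R (fun x => lowerOf R (w.1 x)) t then 1 else 0 := by
  induction hn : badness R s using Nat.strong_induction_on generalizing s with
  | _ n ih =>
    by_cases hbad : ∃ x, s x ∉ Set.range (lowerOf R)
    · obtain ⟨x, hx⟩ := hbad
      have hxn : NonPrin (transp R) (s x) := ⟨hs x, fun e he => hx ⟨Sum.inl e, he.symm⟩⟩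
      rcases hc.reduce _ hxn with ⟨z, hz⟩ | ⟨e, z, hz⟩
      · have hlt : badness R (Function.update s x z.1.1) < n := by
          rw [← hn]
          refine badness_lt hx (by rw [Function.update_self]; exact ⟨Sum.inr z, rfl⟩) ?_
          intro y hy
          rw [Function.update_of_ne (by rintro rfl; exact hx hy)]
          exact hy
        obtain ⟨c, hc⟩ := ih _ hlt _ (by
          intro y
          rcases eq_or_ne y x with rfl | hy
          · rw [Function.update_self]
            exact z.2.left.1
          · rw [Function.update_of_ne hy]
            exact hs y) rfl
        refine ⟨c, fun t ht => ?_⟩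
        rw [← hc t ht, hits_update_iff hxn z.2.left (hz _ (ht x))]
      · have hlt : badness R (Function.update s x (row (transp R) e)) < n := by
          rw [← hn]
          refine badness_lt hx (by rw [Function.update_self]; exact ⟨Sum.inl e, rfl⟩) ?_
          intro y hy
          rw [Function.update_of_ne (by rintro rfl; exact hx hy)]
          exact hy
        have hlt' : badness R (shift R s x e z.1.1) < n := by
          rw [← hn]
          refine badness_lt hx (by rw [shift, if_pos rfl]; exact ⟨Sum.inl e, rfl⟩) ?_
          intro y hy
          unfold shift
          split_ifs
          · exact ⟨Sum.inl e, rfl⟩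
          · exact ⟨Sum.inr z, rfl⟩
          · exact hy
        obtain ⟨c, hc⟩ := ih _ hlt _ (by
          intro y
          rcases eq_or_ne y x with rfl | hy
          · rw [Function.update_self]
            exact hR.isPO_transp.isUp_row e
          · rw [Function.update_of_ne hy]
            exact hs y) rfl
        obtain ⟨c', hc'⟩ := ih _ hlt' _ (by
          intro y
          unfold shift
          split_ifs
          · exact hR.isPO_transp.isUp_row e
          · exact z.2.left.1
          · exact hs y) rfl
        refine ⟨c - c', fun t ht => ?_⟩
        simp only [Pi.sub_apply, sub_mul, Finset.sum_sub_distrib]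
        rw [← hc t ht, ← hc' t ht, hits_update_row hR ht hxn hz]
        have := not_hits_shift ht hxn hz
        by_cases h1 : Hits R s t
        · simp [h1, this h1]
        · by_cases h2 : Hits R (shift R s x e z.1.1) t <;> simp [h1, h2]
    · push Not at hbad
      choose w hw using hbad
      obtain rfl : (fun x => lowerOf R (w x)) = s := funext hw
      by_cases honto : ∀ e, ∃ x, w x = Sum.inl e
      · obtain ⟨v, rfl⟩ : ∃ v : OntoWord R X, v.1 = w := ⟨⟨w, honto⟩, rfl⟩
        refine ⟨Pi.single v 1, fun t _ => ?_⟩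
        rw [Finset.sum_eq_single v]
        · rw [Pi.single_eq_same, one_mul]
        · intro w' _ hne
          rw [Pi.single_eq_of_ne hne, zero_mul]
        · simp
      · refine ⟨0, fun t _ => ?_⟩
        rw [if_neg]
        · simp
        · rintro ⟨-, h2⟩
          refine honto fun e => ?_
          obtain ⟨x, hx, -⟩ := h2 e
          exact ⟨x, hR.lowerOf_injective hx⟩

open Classical in
/-- The matrix of the relation `Below`. -/
noncomputable def belowMat (k : Type*) [Field k] (R : Set (E × E)) (u u' : E ⊕ Pairs R) : k :=
  if Below R (lowerOf R u) (upperOf R u') then 1 else 0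

open Classical in
theorem pairMat_eq_hitMatrix (k : Type*) [Field k] [Fintype E] [Fintype X] (hR : IsPO R)
    (w w' : OntoWord R X) : pairMat k R X w w' = hitMatrix (belowMat k R) w.1 w'.1 := by
  have h1 : pairMat k R X w w' = if Hits R (fun x => lowerOf R (w.1 x))
      (fun x => upperOf R (w'.1 x)) then 1 else 0 :=
    hR.pairing_colRel k (fun x => hR.isUp_lowerOf _) (hR.rcomp_of_mem_Phi (hR.phiOf_mem w'))
  rw [h1]
  unfold hitMatrix belowMat Hits
  have h2 : ∀ e x, (lowerOf R (w.1 x) = row (transp R) e ∧ upperOf R (w'.1 x) = row R e) ↔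
      (w.1 x = Sum.inl e ∧ w'.1 x = Sum.inl e) := fun e x =>
    and_congr (hR.lowerOf_injective.eq_iff (b := Sum.inl e))
      (hR.upperOf_injective.eq_iff (b := Sum.inl e))
  simp only [h2]
  rw [Fintype.prod_ite_zero]
  have h3 : ∀ e, (1 - ∏ x, (1 - if w.1 x = Sum.inl e ∧ w'.1 x = Sum.inl e then 1 else 0) : k) =
      if ∃ x, w.1 x = Sum.inl e ∧ w'.1 x = Sum.inl e then 1 else 0 := by
    intro e
    split_ifs with he
    · obtain ⟨x, hx⟩ := he
      rw [Finset.prod_eq_zero (Finset.mem_univ x) (by rw [if_pos hx, sub_self]), sub_zero]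
    · push Not at he
      rw [Finset.prod_eq_one, sub_self]
      intro x _
      rw [if_neg fun h => he x h.1 h.2, sub_zero]
  simp only [h3]
  rw [Fintype.prod_ite_zero]
  simp only [Finset.prod_const_one]
  rw [ite_and]
  split_ifs <;> simp

theorem Cert.good (k : Type*) [Field k] [Fintype E] [Fintype X] (hR : IsPO R) (hc : Cert R) :
    Good k X R := by
  classical
  refine good_of_regular hR (fun v hv => ?_) fun ψ hψ => ?_
  · obtain ⟨κ, hκ⟩ := hc.triangular
    choose zs hzs hκ using hκ
    let v' : (X → E ⊕ Pairs R) → k := fun w => if h : ∀ e, ∃ x, w x = Sum.inl e then v ⟨w, h⟩ else 0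
    have key : v' = 0 := by
      refine eq_zero_of_sum_hitMatrix (C := belowMat k R) (zs := zs) (κ := κ)
        (ht := fun z => z.1.1.ncard) (fun e => ?_) (fun e z => ?_) (fun e => ?_)
        (fun e f hf h => hκ e f hf fun h' => h ?_) (fun z => ?_) (fun z z' h => ?_)
        (fun w hw => dif_neg hw) fun w' hw' => ?_
      · exact if_pos (hR.below_row_row.2 (hR.refl e))
      · exact if_congr (hzs e z) rfl rfl
      · unfold belowMat
        split_ifs <;> simp
      · exact if_congr (hR.below_row_row.trans h') rfl rfl
      · exact if_pos z.2.below
      · have hb : Below R z'.1.1 z.1.2 := by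
          by_contra hb
          exact h (if_neg hb)
        have hsub := z.2.maxLeft _ z'.2.left hb
        rcases hsub.eq_or_ssubset with heq | hlt
        · left
          exact Sum.inr_injective (hR.lowerOf_injective (a₁ := Sum.inr z') (a₂ := Sum.inr z) heq)
        · exact Or.inr (Set.ncard_lt_ncard hlt (Set.toFinite _))
      · let u : OntoWord R X := ⟨w', hw'⟩
        have h1 : ∑ w, v w * pairMat k R X w u = 0 := congrFun hv u
        simp only [pairMat_eq_hitMatrix k hR] at h1
        refine Eq.trans ?_ h1
        have hinj : Function.Injective fun w : OntoWord R X => w.1 := Subtype.val_injective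
        rw [sum_eq_sum_of_support hinj]
        · exact Finset.sum_congr rfl fun w _ => by rw [show v' w.1 = v w from dif_pos w.2]
        · intro w hw
          exact dif_neg fun h => hw ⟨⟨w, h⟩, rfl⟩
    funext w
    exact (dif_pos w.2).symm.trans (congrFun key w.1)
  · obtain ⟨c, hc⟩ := hc.exists_coeff k hR (fun x => row (transp ψ) x) (hR.rcomp_eq_iff'.1 hψ)
    refine ⟨c, fun φ hφ => ?_⟩
    have h1 := hc (row φ) (hR.rcomp_eq_iff.1 hφ)
    rw [← hR.pairing_colRel k (hR.rcomp_eq_iff'.1 hψ) hφ] at h1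
    refine h1.trans (Finset.sum_congr rfl fun w _ => ?_)
    rw [← hR.pairing_colRel k (fun x => hR.isUp_lowerOf _) hφ]
    rfl

theorem exists_bijective_of_forall_exists {A : Type*} [Fintype E] [Fintype X]
    (hcard : Fintype.card E = Fintype.card X) {i : E → A} (hi : Function.Injective i) {s : X → A}
    (h : ∀ e, ∃ x, s x = i e) : ∃ g : E → X, Function.Bijective g ∧ ∀ e, s (g e) = i e := by
  choose g hg using h
  refine ⟨g, (Fintype.bijective_iff_injective_and_card g).2 ⟨fun a b hab => hi ?_, hcard⟩, hg⟩
  rw [← hg, hab, hg]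

theorem good_of_card_eq (k : Type*) [Field k] [Fintype E] [Fintype X] (hR : IsPO R)
    (hcard : Fintype.card E = Fintype.card X) : Good k X R := by
  classical
  have hone : pairMat k R X = 1 := by
    ext w w'
    have h1 : pairMat k R X w w' = if Hits R (fun x => lowerOf R (w.1 x))
        (fun x => upperOf R (w'.1 x)) then 1 else 0 :=
      hR.pairing_colRel k (fun x => hR.isUp_lowerOf _) (hR.rcomp_of_mem_Phi (hR.phiOf_mem w'))
    rw [h1, Matrix.one_apply]
    refine if_congr ⟨fun h => ?_, ?_⟩ rfl rfl
    · obtain ⟨g, hg, hg'⟩ := exists_bijective_of_forall_exists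
        (s := fun x => (w.1 x, w'.1 x)) (A := (E ⊕ Pairs R) × (E ⊕ Pairs R)) hcard
        (i := fun e => (Sum.inl e, Sum.inl e))
        (fun a b hab => Sum.inl_injective (Prod.ext_iff.1 hab).1)
        (fun e => by
          obtain ⟨x, hx1, hx2⟩ := h.2 e
          exact ⟨x, Prod.ext (hR.lowerOf_injective (a₂ := Sum.inl e) hx1)
            (hR.upperOf_injective (a₂ := Sum.inl e) hx2)⟩)
      refine Subtype.ext (funext fun x => ?_)
      obtain ⟨e, rfl⟩ := hg.2 x
      exact (Prod.ext_iff.1 (hg' e)).1.trans (Prod.ext_iff.1 (hg' e)).2.symm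
    · rintro rfl
      obtain ⟨g, hg, hg'⟩ := exists_bijective_of_forall_exists hcard Sum.inl_injective w.2
      refine ⟨fun x => ?_, fun e => ⟨g e, ?_⟩⟩
      · obtain ⟨e, rfl⟩ := hg.2 x
        simp only [hg']
        exact hR.below_row_row.2 (hR.refl e)
      · simp only [hg']
        exact ⟨rfl, rfl⟩
  refine good_of_regular hR (fun v hv => by rwa [hone, Matrix.vecMul_one] at hv) fun ψ hψ => ?_
  have hpair : ∀ φ, φ ⊚ R = φ → pairing k R ψ φ =
      if Hits R (fun x => row (transp ψ) x) (row φ) then 1 else 0 := fun φ hφ =>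
    hR.pairing_colRel k (hR.rcomp_eq_iff'.1 hψ) hφ
  by_cases honto : ∀ e, ∃ x, row (transp ψ) x = row (transp R) e
  · obtain ⟨g, hg, hg'⟩ := exists_bijective_of_forall_exists hcard
      hR.isPO_transp.row_injective honto
    have hrange : ∀ x, ∃ u, row (transp ψ) x = lowerOf R u := fun x => by
      obtain ⟨e, rfl⟩ := hg.2 x
      exact ⟨Sum.inl e, hg' e⟩
    choose w hw using hrange
    let v : OntoWord R X := ⟨w, fun e => ⟨g e, hR.lowerOf_injective (((hw _).symm.trans (hg' e)))⟩⟩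
    have hv : psiOf R v.1 = ψ := transp_injective (eq_of_row_eq fun x => (hw x).symm)
    refine ⟨Pi.single v 1, fun φ _ => ?_⟩
    rw [Finset.sum_eq_single v, Pi.single_eq_same, one_mul, hv]
    · intro w' _ hne
      rw [Pi.single_eq_of_ne hne, zero_mul]
    · simp
  · refine ⟨0, fun φ hφ => ?_⟩
    rw [hpair φ hφ, if_neg fun h => honto fun e => (h.2 e).imp fun x hx => hx.1]
    simp

end Certificate

section Equivariance

variable {E X : Type} {R : Set (E × E)} {s t : Set E} (τ : Equiv.Perm E)

theorem row_bact (e : E) : row (bact τ R) e = τ ⁻¹' row R (τ e) := rfl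

theorem preimage_eq_row_bact_iff {e : E} : τ ⁻¹' t = row (bact τ R) e ↔ t = row R (τ e) := by
  rw [row_bact, (Set.preimage_injective.2 τ.surjective).eq_iff]

theorem isUp_bact_iff : IsUp (bact τ R) (τ ⁻¹' t) ↔ IsUp R t := by
  refine ⟨fun h a b ha hab => ?_, fun h a b ha hab => h _ _ ha hab⟩
  have := h (τ.symm a) (τ.symm b)
  simpa [mem_bact, ha, hab] using this

theorem nonPrin_bact_iff : NonPrin (bact τ R) (τ ⁻¹' t) ↔ NonPrin R t := by
  refine and_congr (isUp_bact_iff τ) ?_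
  simp only [ne_eq, preimage_eq_row_bact_iff]
  exact τ.forall_congr_right (q := fun e => ¬ t = row R e)

theorem below_bact_iff : Below (bact τ R) (τ ⁻¹' s) (τ ⁻¹' t) ↔ Below R s t := by
  refine ⟨fun h a ha b hb => ?_, fun h a ha b hb => h _ ha _ hb⟩
  have := h (τ.symm a) (by simpa using ha) (τ.symm b) (by simpa using hb)
  simpa [mem_bact] using this

theorem ClosedPair.closedPair_bact (h : ClosedPair R s t) :
    ClosedPair (bact τ R) (τ ⁻¹' s) (τ ⁻¹' t) where
  left := (nonPrin_bact_iff (R := transp R) τ).2 h.left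
  right := (nonPrin_bact_iff τ).2 h.right
  below := (below_bact_iff τ).2 h.below
  maxLeft s' h1 h2 := by
    obtain ⟨s', rfl⟩ : ∃ u, s' = τ ⁻¹' u := ⟨τ.symm ⁻¹' s', by ext; simp⟩
    exact Set.preimage_mono (h.maxLeft _ ((nonPrin_bact_iff (R := transp R) τ).1 h1)
      ((below_bact_iff τ).1 h2))
  maxRight s' h1 h2 := by
    obtain ⟨s', rfl⟩ : ∃ u, s' = τ ⁻¹' u := ⟨τ.symm ⁻¹' s', by ext; simp⟩
    exact Set.preimage_mono (h.maxRight _ ((nonPrin_bact_iff τ).1 h1) ((below_bact_iff τ).1 h2))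

theorem ract_mem_Phi {φ : Set (X × E)} (h : φ ∈ Phi R X) : ract τ φ ∈ Phi (bact τ R) X := by
  refine ⟨fun x => ?_, fun e => ?_⟩
  · obtain ⟨u, hu⟩ := h.1 x
    change ∃ v, _ = τ ⁻¹' row φ x
    rw [← hu]
    rcases u with e | p
    · exact ⟨Sum.inl (τ.symm e), by simp [upperOf, row_bact]⟩
    · exact ⟨Sum.inr ⟨(τ ⁻¹' p.1.1, τ ⁻¹' p.1.2), p.2.closedPair_bact τ⟩, rfl⟩
  · obtain ⟨x, hx⟩ := h.2 (τ e)
    exact ⟨x, (preimage_eq_row_bact_iff τ).2 hx⟩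

theorem lact_mem_Psi {ψ : Set (E × X)} (h : ψ ∈ Psi R X) : lact τ ψ ∈ Psi (bact τ R) X :=
  ract_mem_Phi (R := transp R) τ h

theorem lam_bact (k : Type*) [Field k] (ψ : Set (E × X)) (φ : Set (X × E)) :
    lam k (bact τ R) (lact τ ψ) (ract τ φ) = lam k R ψ φ := by
  classical
  refine linearMap_ext_of fun Q => ?_
  rw [lam_of, lam_of]
  refine if_congr ?_ rfl rfl
  rw [lact_rcomp, lact_rcomp, rcomp_ract, lact_ract, (bact_injective τ).eq_iff]

theorem IsPO.exists_mem_Phi (hR : IsPO R) {ψ : Set (E × X)} (hψ : ψ ∈ Psi R X) :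
    ∃ φ ∈ Phi R X, ψ ⊚ φ = R := by
  rw [← hR.range_psiOf] at hψ
  obtain ⟨w, rfl⟩ := hψ
  refine ⟨_, hR.phiOf_mem w, ?_⟩
  rw [hR.factor_iff_rows (hR.rcomp_of_mem_Psi (hR.psiOf_mem w))
    (hR.rcomp_of_mem_Phi (hR.phiOf_mem w))]
  refine ⟨fun x => ?_, fun e => ?_⟩
  · rw [row_phiOf, row_psiOf]
    rcases w.1 x with e | p
    · exact hR.below_row_row.2 (hR.refl e)
    · exact p.2.below
  · obtain ⟨x, hx⟩ := w.2 e
    refine ⟨x, ?_⟩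
    rw [row_phiOf, row_psiOf, hx]
    exact ⟨rfl, rfl⟩

end Equivariance

section Dimension

/-- The data indexing the functionals `lam`. -/
@[ext]
structure Trip (m : ℕ) (X : Type) : Type where
  /-- The partial order. -/
  rel : Set (Fin m × Fin m)
  /-- The left factor. -/
  left : Set (Fin m × X)
  /-- The right factor. -/
  right : Set (X × Fin m)

/-- Triples as iterated pairs. -/
def tripEquiv (m : ℕ) (X : Type) :
    Set (Fin m × Fin m) × Set (Fin m × X) × Set (X × Fin m) ≃ Trip m X where
  toFun p := ⟨p.1, p.2.1, p.2.2⟩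
  invFun t := (t.rel, t.left, t.right)

noncomputable instance (m : ℕ) (X : Type) [Finite X] : Fintype (Trip m X) :=
  Fintype.ofEquiv _ (tripEquiv m X)

instance (m : ℕ) (X : Type) : MulAction (Equiv.Perm (Fin m)) (Trip m X) where
  smul τ t := ⟨bact τ⁻¹ t.rel, lact τ⁻¹ t.left, ract τ⁻¹ t.right⟩
  one_smul _ := rfl
  mul_smul _ _ _ := rfl

/-- The triples indexing a basis, before taking the quotient by relabelling. -/
def goodTrips (m : ℕ) (X : Type) : SubMulAction (Equiv.Perm (Fin m)) (Trip m X) where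
  carrier := {t | IsPO t.rel ∧ t.left ∈ Psi t.rel X ∧ t.right ∈ Phi t.rel X}
  smul_mem' τ _ h := ⟨h.1.isPO_bact τ⁻¹, lact_mem_Psi τ⁻¹ h.2.1, ract_mem_Phi τ⁻¹ h.2.2⟩

theorem stabilizer_eq_bot {m : ℕ} {X : Type} (t : goodTrips m X) :
    MulAction.stabilizer (Equiv.Perm (Fin m)) t = ⊥ := by
  rw [eq_bot_iff]
  intro τ hτ
  have h1 : lact τ⁻¹ t.1.left = t.1.left := congrArg (fun t : goodTrips m X => t.1.left) hτ
  obtain ⟨φ, -, hφ⟩ := t.2.1.exists_mem_Phi t.2.2.1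
  have h2 : lact τ⁻¹ t.1.rel = lact 1 t.1.rel := by
    rw [← hφ, ← lact_rcomp, h1]
    rfl
  exact inv_eq_one.1 (t.2.1.lact_inj h2)

/-- The orbits of relabelling on the indexing triples. -/
abbrev TripOrbit (m : ℕ) (X : Type) : Type :=
  MulAction.orbitRel.Quotient (Equiv.Perm (Fin m)) (goodTrips m X)

theorem card_tripOrbit (m : ℕ) (X : Type) [Finite X] :
    Nat.card (TripOrbit m X) * m.factorial = Nat.card (goodTrips m X) := by
  rw [Nat.card_congr (MulAction.selfEquivOrbitsQuotientProd (stabilizer_eq_bot (m := m) (X := X))),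
    Nat.card_prod, Nat.card_perm, Nat.card_fin]

variable (k : Type*) [Field k] {X : Type}

/-- The functional attached to a triple. -/
noncomputable def tripLam {m : ℕ} (t : Trip m X) : Module.Dual k (MonoidAlgebra k (Set (X × X))) :=
  lam k t.rel t.left t.right

theorem tripLam_smul {m : ℕ} (τ : Equiv.Perm (Fin m)) (t : Trip m X) :
    tripLam k (τ • t) = tripLam k t :=
  lam_bact τ⁻¹ k t.left t.right

open Classical in
theorem tripLam_of {m : ℕ} (t : Trip m X) (Q : Set (X × X)) :
    tripLam k t (MonoidAlgebra.of k _ Q) = if t.left ⊚ Q ⊚ t.right = t.rel then 1 else 0 :=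
  lam_of _ _ _ _

variable {k}

open Classical in
theorem sum_tripLam_rcomp [Finite X] {m : ℕ} {R₀ : Set (Fin m × Fin m)} (hR₀ : IsPO R₀)
    {c : Trip m X → k} (hsupp : ∀ t ∉ goodTrips m X, c t = 0)
    (hinv : ∀ τ : Equiv.Perm (Fin m), ∀ t, c (τ • t) = c t)
    (hmin : ∀ t, c t ≠ 0 → t.rel.ncard ≤ R₀.ncard)
    {φ' : Set (X × Fin m)} {ψ' : Set (Fin m × X)} (hφ' : φ' ∈ Phi R₀ X) (hψ' : ψ' ∈ Psi R₀ X) :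
    ∑ t, c t * tripLam k t (MonoidAlgebra.of k _ (φ' ⊚ ψ')) = m.factorial *
      ∑ ψ, ∑ φ, c ⟨R₀, ψ, φ⟩ * pairing k R₀ ψ φ' * pairing k R₀ ψ' φ := by
  have hφ := hR₀.rcomp_of_mem_Phi hφ'
  have hψ := hR₀.rcomp_of_mem_Psi hψ'
  have h1 : ∀ t, c t * tripLam k t (MonoidAlgebra.of k _ (φ' ⊚ ψ')) =
      ∑ τ : Equiv.Perm (Fin m), if t.rel = bact τ R₀ then
        c (τ • t) * pairing k R₀ (τ • t).left φ' * pairing k R₀ ψ' (τ • t).right else 0 := by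
    intro t
    by_cases hc : c t = 0
    · simp [hinv, hc]
    have ht : t ∈ goodTrips m X := by
      by_contra h
      exact hc (hsupp t h)
    have hassoc : t.left ⊚ (φ' ⊚ ψ') ⊚ t.right = (t.left ⊚ φ') ⊚ (ψ' ⊚ t.right) := by
      simp only [rcomp_assoc]
    have hfac := ht.1.factor_iff hR₀ (u := t.left ⊚ φ') (v := ψ' ⊚ t.right)
      (by rw [rcomp_assoc, hφ]) (by rw [← rcomp_assoc, hψ]) (hmin t hc)
    have h2 : ∀ τ : Equiv.Perm (Fin m), (if t.rel = bact τ R₀ then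
        c (τ • t) * pairing k R₀ (τ • t).left φ' * pairing k R₀ ψ' (τ • t).right else 0) =
        if bact τ R₀ = t.rel ∧ lact τ R₀ = t.left ⊚ φ' ∧ ract τ R₀ = ψ' ⊚ t.right
        then c t else 0 := by
      intro τ
      have e1 : (τ • t).left ⊚ φ' = R₀ ↔ lact τ R₀ = t.left ⊚ φ' := by
        rw [lact_eq_iff, eq_comm]
        rfl
      have e2 : ψ' ⊚ (τ • t).right = R₀ ↔ ract τ R₀ = ψ' ⊚ t.right := by
        rw [ract_eq_iff, eq_comm]
        rfl
      rw [hinv, pairing, pairing, if_congr e1 rfl rfl, if_congr e2 rfl rfl,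
        if_congr (eq_comm (a := t.rel)) rfl rfl]
      split_ifs <;> simp_all
    rw [Finset.sum_congr rfl fun τ _ => h2 τ, tripLam_of, hassoc, if_congr hfac rfl rfl]
    by_cases hex : ∃ τ : Equiv.Perm (Fin m),
        bact τ R₀ = t.rel ∧ lact τ R₀ = t.left ⊚ φ' ∧ ract τ R₀ = ψ' ⊚ t.right
    · rw [if_pos hex, mul_one]
      obtain ⟨τ, hτ⟩ := hex
      rw [Finset.sum_eq_single τ, if_pos hτ]
      · intro σ _ hσ
        exact if_neg fun h => hσ (hR₀.lact_inj (h.2.1.trans hτ.2.1.symm))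
      · simp
    · rw [if_neg hex, mul_zero, Finset.sum_eq_zero]
      intro τ _
      exact if_neg fun h => hex ⟨τ, h⟩
  rw [Finset.sum_congr rfl fun t _ => h1 t, Finset.sum_comm]
  have h3 : ∀ τ : Equiv.Perm (Fin m), (∑ t : Trip m X, if t.rel = bact τ R₀ then
        c (τ • t) * pairing k R₀ (τ • t).left φ' * pairing k R₀ ψ' (τ • t).right else 0) =
      ∑ ψ, ∑ φ, c ⟨R₀, ψ, φ⟩ * pairing k R₀ ψ φ' * pairing k R₀ ψ' φ := by
    intro τ
    have h4 : ∀ t : Trip m X, t.rel = bact τ R₀ ↔ (τ • t).rel = R₀ := by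
      intro t
      change _ ↔ bact τ⁻¹ t.rel = R₀
      constructor <;> intro h
      · rw [h, ← bact_mul, mul_inv_cancel]
        rfl
      · rw [← h, ← bact_mul, inv_mul_cancel]
        rfl
    simp only [h4]
    refine (Equiv.sum_comp (MulAction.toPerm τ) fun t : Trip m X => if t.rel = R₀ then
      c t * pairing k R₀ t.left φ' * pairing k R₀ ψ' t.right else 0).trans ?_
    rw [← (tripEquiv m X).sum_comp, Fintype.sum_prod_type, Finset.sum_eq_single R₀]
    · rw [Fintype.sum_prod_type]
      simp [tripEquiv]
    · intro R _ hR
      simp [tripEquiv, hR]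
    · simp
  rw [Finset.sum_congr rfl fun τ _ => h3 τ, Finset.sum_const, Finset.card_univ,
    Fintype.card_perm, Fintype.card_fin, nsmul_eq_mul]

end Dimension

section Basis

variable {k : Type*} [Field k] {X : Type}

theorem coeff_eq_zero [CharZero k] [Finite X] {n : ℕ} {c : ∀ m : Fin n, Trip m X → k}
    (hgood : ∀ (m : Fin n) (R : Set (Fin m × Fin m)), IsPO R → Good k X R)
    (hsupp : ∀ m : Fin n, ∀ t ∉ goodTrips m X, c m t = 0)
    (hinv : ∀ m : Fin n, ∀ τ : Equiv.Perm (Fin m), ∀ t, c m (τ • t) = c m t)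
    (hsum : ∑ m, ∑ t, c m t • tripLam k t = 0) (m : Fin n) (t : Trip m X) : c m t = 0 := by
  classical
  by_contra hct
  obtain ⟨m, hm, hlow⟩ := (Finset.univ.filter fun m : Fin n => ∃ t, c m t ≠ 0).exists_min_image id
    ⟨m, by simpa using ⟨t, hct⟩⟩
  simp only [Finset.mem_filter, Finset.mem_univ, true_and, id_eq] at hm hlow
  obtain ⟨t₀, ht₀⟩ := hm
  obtain ⟨⟨R, ψ, φ⟩, ht, hmax⟩ :=
    (Finset.univ.filter fun t : Trip m X => c m t ≠ 0).exists_max_image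
    (fun t => t.rel.ncard) ⟨t₀, by simpa using ht₀⟩
  simp only [Finset.mem_filter, Finset.mem_univ, true_and] at ht hmax
  have hR : IsPO R := by
    by_contra h
    exact ht (hsupp m ⟨R, ψ, φ⟩ fun h' => h h'.1)
  have key : ∀ φ' ∈ Phi R X, ∀ ψ' ∈ Psi R X,
      ∑ ψ, ∑ φ, c m ⟨R, ψ, φ⟩ * pairing k R ψ φ' * pairing k R ψ' φ = 0 := by
    intro φ' hφ' ψ' hψ'
    have h := sum_tripLam_rcomp hR (hsupp m) (hinv m) hmax hφ' hψ'
    have h' := congrArg (fun f => f (MonoidAlgebra.of k _ (φ' ⊚ ψ'))) hsum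
    simp only [LinearMap.sum_apply, LinearMap.smul_apply, smul_eq_mul, LinearMap.zero_apply] at h'
    rw [Finset.sum_eq_single m, h] at h'
    · exact (mul_eq_zero.1 h').resolve_left (Nat.cast_ne_zero.2 (Nat.factorial_ne_zero _))
    · intro m' _ hne
      refine Finset.sum_eq_zero fun t _ => ?_
      by_cases hc : c m' t = 0
      · rw [hc, zero_mul]
      rw [tripLam_of, if_neg, mul_zero]
      intro hfac
      have hassoc : t.left ⊚ (φ' ⊚ ψ') ⊚ t.right = (t.left ⊚ φ') ⊚ (ψ' ⊚ t.right) := by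
        simp only [rcomp_assoc]
      rw [hassoc] at hfac
      have hPO : IsPO t.rel := by
        by_contra h
        exact hc (hsupp m' _ fun h' => h h'.1)
      have h1 := hPO.card_le_of_factor hfac
      rw [Fintype.card_fin, Fintype.card_fin] at h1
      exact hne (le_antisymm h1 (hlow m' ⟨t, hc⟩))
    · simp
  have h1 : ∀ ψ' ∈ Psi R X, (fun ψ => ∑ φ, c m ⟨R, ψ, φ⟩ * pairing k R ψ' φ) = 0 := by
    intro ψ' hψ'
    refine (hgood m R hR).nondegPsi _ (fun ψ hψ => Finset.sum_eq_zero fun φ _ => ?_)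
      fun φ' hφ' => ?_
    · rw [hsupp m ⟨R, ψ, φ⟩ fun h => hψ h.2.1, zero_mul]
    · rw [← key φ' hφ' ψ' hψ']
      refine Finset.sum_congr rfl fun ψ _ => ?_
      rw [Finset.sum_mul]
      exact Finset.sum_congr rfl fun φ _ => by ring
  have h2 := (hgood m R hR).nondegPhi (fun φ => c m ⟨R, ψ, φ⟩)
    (fun φ hφ => hsupp m ⟨R, ψ, φ⟩ fun h => hφ h.2.2) fun ψ' hψ' => congrFun (h1 ψ' hψ') ψ
  exact ht (congrFun h2 φ)

open Classical in
/-- An invariant function on triples from a function on orbits. -/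
noncomputable def orbitLift {n : ℕ} (g : (Σ m : Fin n, TripOrbit m X) → k) (m : Fin n)
    (t : Trip m X) : k :=
  if h : t ∈ goodTrips m X then g ⟨m, Quotient.mk'' ⟨t, h⟩⟩ else 0

theorem orbitLift_smul {n : ℕ} (g : (Σ m : Fin n, TripOrbit m X) → k) (m : Fin n)
    (τ : Equiv.Perm (Fin m)) (t : Trip m X) : orbitLift g m (τ • t) = orbitLift g m t := by
  have hiff : τ • t ∈ goodTrips m X ↔ t ∈ goodTrips m X :=
    ⟨fun h => inv_smul_smul τ t ▸ (goodTrips m X).smul_mem τ⁻¹ h, (goodTrips m X).smul_mem τ⟩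
  by_cases h : t ∈ goodTrips m X
  · rw [orbitLift, orbitLift, dif_pos h, dif_pos (hiff.2 h)]
    congr 2
    exact Quotient.sound' ⟨τ, rfl⟩
  · rw [orbitLift, orbitLift, dif_neg h, dif_neg (hiff.not.2 h)]

variable (k X) in
/-- The linear map sending coefficients on orbits to a combination of functionals. -/
noncomputable def orbitMap [Finite X] (n : ℕ) :
    ((Σ m : Fin n, TripOrbit m X) → k) →ₗ[k] Module.Dual k (MonoidAlgebra k (Set (X × X))) where
  toFun g := ∑ m, ∑ t, orbitLift g m t • tripLam k t
  map_add' g h := by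
    simp only [← Finset.sum_add_distrib, ← add_smul]
    refine Finset.sum_congr rfl fun m _ => Finset.sum_congr rfl fun t _ => ?_
    by_cases h : t ∈ goodTrips m X <;> simp [orbitLift, h]
  map_smul' a g := by
    simp only [Finset.smul_sum, smul_smul, RingHom.id_apply]
    refine Finset.sum_congr rfl fun m _ => Finset.sum_congr rfl fun t _ => ?_
    by_cases h : t ∈ goodTrips m X <;> simp [orbitLift, h]

theorem orbitMap_injective [CharZero k] [Finite X] {n : ℕ}
    (hgood : ∀ (m : Fin n) (R : Set (Fin m × Fin m)), IsPO R → Good k X R) :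
    Function.Injective (orbitMap k X n) := by
  rw [← LinearMap.ker_eq_bot, LinearMap.ker_eq_bot']
  intro g hg
  ext ⟨m, o⟩
  obtain ⟨t, rfl⟩ := Quotient.exists_rep o
  have := coeff_eq_zero (c := orbitLift g) hgood (fun m t ht => dif_neg ht)
    (orbitLift_smul g) hg m t.1
  rwa [orbitLift, dif_pos t.2] at this

theorem tripLam_mem_range [CharZero k] [Finite X] {n : ℕ} {m : Fin n} {t₀ : Trip m X}
    (h₀ : t₀ ∈ goodTrips m X) : tripLam k t₀ ∈ LinearMap.range (orbitMap k X n) := by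
  classical
  let g : (Σ m : Fin n, TripOrbit m X) → k := Pi.single ⟨m, Quotient.mk'' ⟨t₀, h₀⟩⟩ 1
  have h1 : ∀ t : Trip m X, orbitLift g m t • tripLam k t =
      (if ∃ τ : Equiv.Perm (Fin m), τ • t₀ = t then (1 : k) else 0) • tripLam k t₀ := by
    intro t
    by_cases hex : ∃ τ : Equiv.Perm (Fin m), τ • t₀ = t
    · obtain ⟨τ, rfl⟩ := hex
      rw [if_pos ⟨τ, rfl⟩, orbitLift_smul, tripLam_smul, orbitLift, dif_pos h₀]
      simp only [g, Pi.single_eq_same]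
    · rw [if_neg hex, zero_smul, orbitLift]
      split_ifs with h
      · simp only [g]
        rw [Pi.single_eq_of_ne, zero_smul]
        intro heq
        obtain ⟨τ, hτ⟩ := Quotient.exact' (eq_of_heq (Sigma.mk.inj heq).2)
        exact hex ⟨τ, congrArg Subtype.val hτ⟩
      · rw [zero_smul]
  have h2 : orbitMap k X n g =
      ((Finset.univ.filter fun t : Trip m X => ∃ τ : Equiv.Perm (Fin m), τ • t₀ = t).card : k) •
        tripLam k t₀ := by
    change ∑ m, ∑ t, orbitLift g m t • tripLam k t = _
    rw [Finset.sum_eq_single m, Finset.sum_congr rfl fun t _ => h1 t, ← Finset.sum_smul,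
      Finset.sum_boole]
    · intro m' _ hne
      refine Finset.sum_eq_zero fun t _ => ?_
      rw [orbitLift]
      split_ifs with h
      · simp only [g]
        rw [Pi.single_eq_of_ne, zero_smul]
        intro heq
        exact hne (congrArg Sigma.fst heq)
      · rw [zero_smul]
    · simp
  have h3 : ((Finset.univ.filter fun t : Trip m X =>
      ∃ τ : Equiv.Perm (Fin m), τ • t₀ = t).card : k) ≠ 0 := by
    rw [Nat.cast_ne_zero, Finset.card_ne_zero]
    exact ⟨t₀, by simpa using ⟨1, one_smul _ t₀⟩⟩
  rw [← inv_smul_smul₀ h3 (tripLam k t₀), ← h2]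
  exact Submodule.smul_mem _ _ ⟨g, rfl⟩

theorem lam_eq_sum_right {E : Type} [Finite E] [Finite X] {R : Set (E × E)} {ψ : Set (E × X)}
    {φ : Set (X × E)} {b : Set (X × E) → k} (hψ : R ⊚ ψ = ψ)
    (hb : ∀ ψ, R ⊚ ψ = ψ → pairing k R ψ φ = ∑ φ', b φ' * pairing k R ψ φ') :
    lam k R ψ φ = ∑ φ', b φ' • lam k R ψ φ' := by
  classical
  refine linearMap_ext_of fun Q => ?_
  simp only [LinearMap.sum_apply, LinearMap.smul_apply, smul_eq_mul, lam_of]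
  exact hb (ψ ⊚ Q) (by rw [← rcomp_assoc, hψ])

theorem lam_eq_sum_left {E : Type} [Finite E] [Finite X] {R : Set (E × E)} {ψ : Set (E × X)}
    {φ : Set (X × E)} {b : Set (E × X) → k} (hφ : φ ⊚ R = φ)
    (hb : ∀ φ, φ ⊚ R = φ → pairing k R ψ φ = ∑ ψ', b ψ' * pairing k R ψ' φ) :
    lam k R ψ φ = ∑ ψ', b ψ' • lam k R ψ' φ := by
  classical
  refine linearMap_ext_of fun Q => ?_
  simp only [LinearMap.sum_apply, LinearMap.smul_apply, smul_eq_mul, lam_of, rcomp_assoc]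
  exact hb (Q ⊚ φ) (by rw [rcomp_assoc, hφ])

theorem range_orbitMap [CharZero k] [Fintype X]
    (hgood : ∀ (m : Fin (Fintype.card X + 1)) (R : Set (Fin m × Fin m)), IsPO R → Good k X R) :
    LinearMap.range (orbitMap k X (Fintype.card X + 1)) = functionals k X := by
  classical
  refine le_antisymm ?_ (Submodule.span_le.2 ?_)
  · rintro _ ⟨g, rfl⟩
    change ∑ m, ∑ t, orbitLift g m t • tripLam k t ∈ functionals k X
    refine Submodule.sum_mem _ fun m _ => Submodule.sum_mem _ fun t _ => ?_
    by_cases h : t ∈ goodTrips m X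
    · exact Submodule.smul_mem _ _ (Submodule.subset_span ⟨m, t.rel, t.left, t.right, h.1,
        h.1.rcomp_of_mem_Psi h.2.1, h.1.rcomp_of_mem_Phi h.2.2, rfl⟩)
    · rw [orbitLift, dif_neg h, zero_smul]
      exact Submodule.zero_mem _
  · rintro _ ⟨m, R, ψ, φ, hR, hψ, hφ, rfl⟩
    by_cases hm : m < Fintype.card X + 1
    · lift m to Fin (Fintype.card X + 1) using hm
      obtain ⟨b, hb, hbφ⟩ := (hgood m R hR).spanPhi φ hφ
      obtain ⟨b', hb', hbψ⟩ := (hgood m R hR).spanPsi ψ hψ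
      rw [lam_eq_sum_right hψ hbφ]
      refine Submodule.sum_mem _ fun φ' _ => ?_
      by_cases hφ' : φ' ∈ Phi R X
      · refine Submodule.smul_mem _ _ ?_
        rw [lam_eq_sum_left (hR.rcomp_of_mem_Phi hφ') hbψ]
        refine Submodule.sum_mem _ fun ψ' _ => ?_
        by_cases hψ' : ψ' ∈ Psi R X
        · exact Submodule.smul_mem _ _
            (tripLam_mem_range (t₀ := ⟨R, ψ', φ'⟩) ⟨hR, hψ', hφ'⟩)
        · rw [hb' _ hψ', zero_smul]
          exact Submodule.zero_mem _
      · rw [hb _ hφ', zero_smul]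
        exact Submodule.zero_mem _
    · have : lam k R ψ φ = 0 := by
        refine linearMap_ext_of fun Q => ?_
        rw [lam_of, if_neg, LinearMap.zero_apply]
        intro h
        have := hR.card_le_of_factor h
        rw [Fintype.card_fin] at this
        omega
      rw [this]
      exact Submodule.zero_mem _

theorem finrank_functionals [CharZero k] [Fintype X]
    (hgood : ∀ (m : Fin (Fintype.card X + 1)) (R : Set (Fin m × Fin m)), IsPO R → Good k X R) :
    Module.finrank k (functionals k X) =
      ∑ m : Fin (Fintype.card X + 1), Nat.card (TripOrbit m X) := by
  classical
  rw [← range_orbitMap hgood, LinearMap.finrank_range_of_inj (orbitMap_injective hgood)]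
  have : ∀ m : ℕ, Finite (TripOrbit m X) := fun m => Quotient.finite _
  cases nonempty_fintype (Σ m : Fin (Fintype.card X + 1), TripOrbit m X)
  rw [Module.finrank_fintype_fun_eq_card, ← Nat.card_eq_fintype_card, Nat.card_sigma]

open Classical in
theorem card_goodTrips (m : ℕ) (X : Type) [Finite X] :
    Nat.card (goodTrips m X) = ∑ R : Set (Fin m × Fin m),
      if IsPO R then Nat.card (OntoWord R X) ^ 2 else 0 := by
  let e : goodTrips m X ≃ Σ R : {R : Set (Fin m × Fin m) // IsPO R}, Psi R.1 X × Phi R.1 X :=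
    { toFun t := ⟨⟨t.1.rel, t.2.1⟩, ⟨t.1.left, t.2.2.1⟩, ⟨t.1.right, t.2.2.2⟩⟩
      invFun p := ⟨⟨p.1.1, p.2.1.1, p.2.2.1⟩, p.1.2, p.2.1.2, p.2.2.2⟩
      left_inv _ := rfl
      right_inv _ := rfl }
  rw [Nat.card_congr e, Nat.card_sigma, ← Finset.sum_filter]
  rw [Finset.sum_subtype (p := IsPO) _ (by simp)]
  refine Finset.sum_congr rfl fun R _ => ?_
  rw [Nat.card_prod, Nat.card_coe_set_eq, Nat.card_coe_set_eq, R.2.ncard_Phi, R.2.ncard_Psi, sq]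

end Basis

section Encoding

/-- The subset of `Fin n` with a given binary code. -/
def setOfCode (n d : ℕ) : Set (Fin n) := {i | d.testBit i = true}

/-- The relation on `Fin n` with a given binary code. -/
def relOfCode (n c : ℕ) : Set (Fin n × Fin n) := {p | c.testBit (8 * p.1 + p.2) = true}

theorem mem_setOfCode {n d : ℕ} {i : Fin n} : i ∈ setOfCode n d ↔ d.testBit i = true := Iff.rfl

theorem mem_relOfCode {n c : ℕ} {i j : Fin n} :
    (i, j) ∈ relOfCode n c ↔ c.testBit (8 * i + j) = true := Iff.rfl

theorem exists_setOfCode {n : ℕ} (s : Set (Fin n)) : ∃ d < 2 ^ n, setOfCode n d = s := by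
  classical
  refine ⟨Nat.ofBits fun i : Fin n => decide (i ∈ s), Nat.ofBits_lt_two_pow _, ?_⟩
  ext i
  rw [mem_setOfCode, Nat.testBit_ofBits_lt _ _ i.2]
  simp

theorem setOfCode_inj {n d d' : ℕ} (hd : d < 2 ^ n) (hd' : d' < 2 ^ n)
    (h : setOfCode n d = setOfCode n d') : d = d' := by
  refine Nat.eq_of_testBit_eq fun i => ?_
  by_cases hi : i < n
  · rw [Bool.eq_iff_iff]
    exact Set.ext_iff.1 h ⟨i, hi⟩
  · have h2 : 2 ^ n ≤ 2 ^ i := Nat.pow_le_pow_right two_pos (not_lt.1 hi)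
    rw [Nat.testBit_lt_two_pow (hd.trans_le h2), Nat.testBit_lt_two_pow (hd'.trans_le h2)]

theorem sum_set_eq {n : ℕ} [Fintype (Set (Fin n))] {M : Type*} [AddCommMonoid M]
    (F : Set (Fin n) → M) : ∑ s, F s =
      ((List.range (2 ^ n)).map fun d => F (setOfCode n d)).sum := by
  have h : (∑ d ∈ Finset.range (2 ^ n), F (setOfCode n d)) = ∑ s, F s :=
    Finset.sum_bij (fun d _ => setOfCode n d) (fun _ _ => Finset.mem_univ _)
      (fun d hd d' hd' h => setOfCode_inj (Finset.mem_range.1 hd) (Finset.mem_range.1 hd') h)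
      (fun s _ => by
        obtain ⟨d, hd, rfl⟩ := exists_setOfCode s
        exact ⟨d, Finset.mem_range.2 hd, rfl⟩) (fun _ _ => rfl)
  rw [← h]
  rfl

/-- The extension of a relation on `Fin n` by a new last point, with `D` below and `U` above. -/
def extRel {n : ℕ} (R : Set (Fin n × Fin n)) (D U : Set (Fin n)) :
    Set (Fin (n + 1) × Fin (n + 1)) :=
  {p | Fin.lastCases (Fin.lastCases True (fun j => j ∈ U) p.2)
    (fun i => Fin.lastCases (i ∈ D) (fun j => (i, j) ∈ R) p.2) p.1}

section ExtRel

variable {n : ℕ} {R : Set (Fin n × Fin n)} {D U : Set (Fin n)}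

@[simp] theorem last_last_mem_extRel : (Fin.last n, Fin.last n) ∈ extRel R D U := by
  simp [extRel]

@[simp] theorem last_castSucc_mem_extRel {j : Fin n} :
    (Fin.last n, j.castSucc) ∈ extRel R D U ↔ j ∈ U := by
  simp [extRel]

@[simp] theorem castSucc_last_mem_extRel {i : Fin n} :
    (i.castSucc, Fin.last n) ∈ extRel R D U ↔ i ∈ D := by
  simp [extRel]

@[simp] theorem castSucc_castSucc_mem_extRel {i j : Fin n} :
    (i.castSucc, j.castSucc) ∈ extRel R D U ↔ (i, j) ∈ R := by
  simp [extRel]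

/-- The condition for an extension of a partial order to be a partial order. -/
structure ValidExt (R : Set (Fin n × Fin n)) (D U : Set (Fin n)) : Prop where
  down : IsUp (transp R) D
  up : IsUp R U
  below : Below R D U
  disj : ∀ i ∈ D, i ∉ U

theorem isPO_extRel_iff : IsPO (extRel R D U) ↔ IsPO R ∧ ValidExt R D U := by
  constructor
  · intro h
    refine ⟨⟨fun i => ?_, fun {i j l} h1 h2 => ?_, fun {i j} h1 h2 => ?_⟩, fun i j hi hji => ?_,
      fun i j hi hij => ?_, fun i hi j hj => ?_, fun i hi hi' => ?_⟩
    · simpa using h.refl i.castSucc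
    · simpa using h.trans (castSucc_castSucc_mem_extRel.2 h1) (castSucc_castSucc_mem_extRel.2 h2)
    · simpa using h.antisymm (castSucc_castSucc_mem_extRel.2 h1)
        (castSucc_castSucc_mem_extRel.2 h2)
    · simpa using h.trans (castSucc_castSucc_mem_extRel.2 hji) (castSucc_last_mem_extRel.2 hi)
    · simpa using h.trans (last_castSucc_mem_extRel.2 hi) (castSucc_castSucc_mem_extRel.2 hij)
    · simpa using h.trans (castSucc_last_mem_extRel.2 hi) (last_castSucc_mem_extRel.2 hj)
    · exact (Fin.castSucc_lt_last i).ne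
        (h.antisymm (castSucc_last_mem_extRel.2 hi) (last_castSucc_mem_extRel.2 hi'))
  · rintro ⟨h, hv⟩
    refine ⟨fun i => ?_, fun {i j l} => ?_, fun {i j} => ?_⟩
    · cases i using Fin.lastCases with
      | last => simp
      | cast i => simpa using h.refl i
    · cases i using Fin.lastCases <;> cases j using Fin.lastCases <;>
        cases l using Fin.lastCases <;> simp
      case last.cast.cast i j => exact hv.up i j
      case cast.last.cast i j => exact fun h1 h2 => hv.below i h1 j h2
      case cast.cast.last i j => exact fun h1 h2 => hv.down j i h2 h1
      case cast.cast.cast i j l => exact fun h1 h2 => h.trans h1 h2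
    · cases i using Fin.lastCases <;> cases j using Fin.lastCases <;> simp
      case last.cast i => exact fun h1 h2 => (hv.disj i h2 h1).elim
      case cast.last i => exact fun h1 h2 => (hv.disj i h1 h2).elim
      case cast.cast i j => exact fun h1 h2 => h.antisymm h1 h2

theorem extRel_restrict {R : Set (Fin (n + 1) × Fin (n + 1))} (h : IsPO R) :
    extRel {p | (p.1.castSucc, p.2.castSucc) ∈ R} {i | (i.castSucc, Fin.last n) ∈ R}
      {i | (Fin.last n, i.castSucc) ∈ R} = R := by
  ext ⟨i, j⟩
  cases i using Fin.lastCases <;> cases j using Fin.lastCases <;> simp [h.refl]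

end ExtRel

open Classical in
theorem sum_isPO_succ {n : ℕ} {M : Type*} [AddCommMonoid M]
    (G : Set (Fin (n + 1) × Fin (n + 1)) → M) :
    ∑ R with IsPO R, G R = ∑ R : Set (Fin n × Fin n) with IsPO R,
      ∑ D : Set (Fin n), ∑ U : Set (Fin n), if ValidExt R D U then G (extRel R D U) else 0 := by
  rw [Finset.sum_filter (fun R : Set (Fin n × Fin n) => IsPO R)]
  have h : ∀ R : Set (Fin n × Fin n), (if IsPO R then ∑ D : Set (Fin n), ∑ U : Set (Fin n),
      if ValidExt R D U then G (extRel R D U) else 0 else 0) =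
      ∑ D : Set (Fin n), ∑ U : Set (Fin n),
        if IsPO (extRel R D U) then G (extRel R D U) else 0 := by
    intro R
    by_cases hR : IsPO R
    · simp [isPO_extRel_iff, hR]
    · simp [isPO_extRel_iff, hR]
  rw [Finset.sum_congr rfl fun R _ => h R]
  simp only [← Fintype.sum_prod_type']
  rw [← Finset.sum_filter]
  refine Finset.sum_bij' (fun R _ => ({p | (p.1.castSucc, p.2.castSucc) ∈ R},
      {i | (i.castSucc, Fin.last n) ∈ R}, {i | (Fin.last n, i.castSucc) ∈ R}))
    (fun p _ => extRel p.1 p.2.1 p.2.2) ?_ ?_ ?_ ?_ ?_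
  · intro R hR
    rw [Finset.mem_filter] at hR ⊢
    exact ⟨Finset.mem_univ _, (extRel_restrict hR.2).symm ▸ hR.2⟩
  · simp
  · exact fun R hR => extRel_restrict (Finset.mem_filter.1 hR).2
  · rintro ⟨R, D, U⟩ _
    simp
  · exact fun R hR => by rw [extRel_restrict (Finset.mem_filter.1 hR).2]

/-- The code of an extension. -/
def extCode (n c d u : ℕ) : ℕ :=
  Nat.ofBits fun k : Fin (8 * (n + 1)) =>
    bif k.1 / 8 == n then k.1 % 8 == n || u.testBit (k.1 % 8)
    else bif k.1 % 8 == n then d.testBit (k.1 / 8) else c.testBit k.1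

theorem relOfCode_extCode {n : ℕ} (hn : n < 8) (c d u : ℕ) :
    relOfCode (n + 1) (extCode n c d u) =
      extRel (relOfCode n c) (setOfCode n d) (setOfCode n u) := by
  have key : ∀ i ≤ n, ∀ j ≤ n, (extCode n c d u).testBit (8 * i + j) =
      bif i == n then j == n || u.testBit j
      else bif j == n then d.testBit i else c.testBit (8 * i + j) := by
    intro i hi j hj
    rw [extCode, Nat.testBit_ofBits_lt _ _ (by omega)]
    have h1 : (8 * i + j) / 8 = i := by omega
    have h2 : (8 * i + j) % 8 = j := by omega
    simp only [h1, h2]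
  ext ⟨i, j⟩
  rw [mem_relOfCode, key _ i.is_le _ j.is_le]
  cases i using Fin.lastCases <;> cases j using Fin.lastCases <;>
    simp [mem_setOfCode, mem_relOfCode, Fin.is_lt, Nat.ne_of_lt]

/-- Test whether a coded set is an up-set. -/
def isUpCode (n c t : ℕ) : Bool :=
  (List.range n).all fun i => !t.testBit i ||
    (List.range n).all fun j => !c.testBit (8 * i + j) || t.testBit j

/-- Test whether a coded set is a down-set. -/
def isDownCode (n c s : ℕ) : Bool :=
  (List.range n).all fun i => !s.testBit i ||
    (List.range n).all fun j => !c.testBit (8 * j + i) || s.testBit j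

/-- Test whether one coded set is below another. -/
def belowCode (n c s t : ℕ) : Bool :=
  (List.range n).all fun i => !s.testBit i ||
    (List.range n).all fun j => !t.testBit j || c.testBit (8 * i + j)

theorem all_range_iff {n : ℕ} {p : ℕ → Bool} :
    (List.range n).all p = true ↔ ∀ i : Fin n, p i = true := by
  simp [Fin.forall_iff]

theorem isUpCode_iff {n c t : ℕ} :
    isUpCode n c t = true ↔ IsUp (relOfCode n c) (setOfCode n t) := by
  simp only [isUpCode, all_range_iff, Bool.or_eq_true, Bool.not_eq_true', IsUp, mem_setOfCode,
    mem_relOfCode, ← Bool.not_eq_true, ← imp_iff_not_or]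
  exact ⟨fun h a b ha => h a ha b, fun h a ha b => h a b ha⟩

theorem isDownCode_iff {n c s : ℕ} :
    isDownCode n c s = true ↔ IsUp (transp (relOfCode n c)) (setOfCode n s) := by
  simp only [isDownCode, all_range_iff, Bool.or_eq_true, Bool.not_eq_true', IsUp, mem_setOfCode,
    mem_transp, mem_relOfCode, ← Bool.not_eq_true, ← imp_iff_not_or]
  exact ⟨fun h a b ha => h a ha b, fun h a ha b => h a b ha⟩

theorem belowCode_iff {n c s t : ℕ} :
    belowCode n c s t = true ↔ Below (relOfCode n c) (setOfCode n s) (setOfCode n t) := by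
  simp only [belowCode, all_range_iff, Bool.or_eq_true, Bool.not_eq_true', Below, mem_setOfCode,
    mem_relOfCode, ← Bool.not_eq_true, ← imp_iff_not_or]

/-- The codes of the partial orders on `Fin n`. -/
def posetCodes : ℕ → List ℕ
  | 0 => [0]
  | n + 1 => (posetCodes n).flatMap fun c =>
      ((List.range (2 ^ n)).filter (isDownCode n c)).flatMap fun d =>
        ((List.range (2 ^ n)).filter fun u =>
          (List.range n).all (fun i => !d.testBit i || !u.testBit i) &&
            (belowCode n c d u && isUpCode n c u)).map (extCode n c d)

theorem sum_map_filter {M : Type*} [AddCommMonoid M] {A : Type*} (l : List A) (p : A → Bool)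
    (f : A → M) : ((l.filter p).map f).sum =
      (l.map fun a => if p a = true then f a else 0).sum := by
  induction l with
  | nil => rfl
  | cons a l ih => by_cases h : p a <;> simp [h, ih]

theorem sum_map_flatMap {M : Type*} [AddCommMonoid M] {A B : Type*} (l : List A) (g : A → List B)
    (f : B → M) : ((l.flatMap g).map f).sum = (l.map fun a => ((g a).map f).sum).sum := by
  induction l with
  | nil => rfl
  | cons a l ih => simp [ih]

open Classical in
theorem sum_isPO {M : Type*} [AddCommMonoid M] {n : ℕ} (hn : n ≤ 8)
    (G : Set (Fin n × Fin n) → M) :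
    ∑ R with IsPO R, G R = ((posetCodes n).map fun c => G (relOfCode n c)).sum := by
  induction n with
  | zero =>
    rw [Finset.filter_true_of_mem, Fintype.sum_subsingleton _ (relOfCode 0 0)]
    · simp [posetCodes]
    · exact fun R _ => ⟨fun i => i.elim0, fun {i} => i.elim0, fun {i} => i.elim0⟩
  | succ n ih =>
    rw [sum_isPO_succ, ih (by omega), posetCodes, sum_map_flatMap]
    congr 2
    funext c
    rw [sum_set_eq, sum_map_flatMap, sum_map_filter]
    congr 2
    funext d
    rw [sum_set_eq, List.map_map, sum_map_filter]
    by_cases hd : isDownCode n c d = true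
    · rw [if_pos hd]
      congr 2
      funext u
      refine if_congr ?_ (by rw [Function.comp, relOfCode_extCode (by omega)]) rfl
      rw [Bool.and_eq_true, Bool.and_eq_true, belowCode_iff, isUpCode_iff, all_range_iff]
      rw [isDownCode_iff] at hd
      simp only [Bool.or_eq_true, Bool.not_eq_true', ← Bool.not_eq_true, ← imp_iff_not_or]
      exact ⟨fun h => ⟨h.disj, h.below, h.up⟩, fun h => ⟨hd, h.2.2, h.2.1, h.1⟩⟩
    · rw [if_neg hd]
      refine List.sum_eq_zero fun x hx => ?_
      obtain ⟨u, -, rfl⟩ := List.mem_map.1 hx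
      exact if_neg fun h => hd (isDownCode_iff.2 h.down)

end Encoding

section PairCodes

/-- The codes of the non principal up-sets. -/
def upCodes (n c : ℕ) : List ℕ :=
  (List.range (2 ^ n)).filter fun t => isUpCode n c t &&
    (List.range n).all fun e => (List.range n).any fun j => t.testBit j != c.testBit (8 * e + j)

/-- The codes of the non principal down-sets. -/
def downCodes (n c : ℕ) : List ℕ :=
  (List.range (2 ^ n)).filter fun s => isDownCode n c s &&
    (List.range n).all fun e => (List.range n).any fun j => s.testBit j != c.testBit (8 * j + e)

/-- Test for inclusion of coded sets. -/
def subCode (n s t : ℕ) : Bool := (List.range n).all fun i => !s.testBit i || t.testBit i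

/-- The codes of the closed pairs. -/
def pairCodes (n c : ℕ) : List (ℕ × ℕ) :=
  (downCodes n c ×ˢ upCodes n c).filter fun p => belowCode n c p.1 p.2 &&
    ((downCodes n c).all (fun s => !belowCode n c s p.2 || subCode n s p.1) &&
      (upCodes n c).all fun t => !belowCode n c p.1 t || subCode n t p.2)

/-- Test whether a coded set is below a point. -/
def belowPoint (n c s b : ℕ) : Bool :=
  (List.range n).all fun a => !s.testBit a || c.testBit (8 * a + b)

/-- Test whether a point is below a coded set. -/
def pointBelow (n c f t : ℕ) : Bool :=
  (List.range n).all fun b => !t.testBit b || c.testBit (8 * f + b)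

/-- Test whether a closed pair can replace a point in the triangularity condition. -/
def replaces (n c : ℕ) (l : List (ℕ × ℕ)) (e : ℕ) (z : ℕ × ℕ) : Bool :=
  l.all fun y => belowPoint n c y.1 e == belowCode n c y.1 z.2

/-- The weight of a point in the triangularity condition. -/
def weight (n c : ℕ) (l : List (ℕ × ℕ)) (e : ℕ) : ℕ :=
  bif l.any fun z => replaces n c l e z && pointBelow n c e z.2 then
    (List.range n).countP fun g => c.testBit (8 * e + g)
  else (List.range n).countP fun g => c.testBit (8 * g + e)

/-- Test for the reduction condition. -/
def reduceCode (n c : ℕ) (l : List (ℕ × ℕ)) (s : ℕ) : Bool :=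
  (l.any fun z => (List.range n).all fun b => belowPoint n c s b == belowPoint n c z.1 b) ||
    (List.range n).any fun e =>
      ((List.range n).all fun b => belowPoint n c s b == c.testBit (8 * e + b)) &&
        l.any fun z => (List.range n).all fun b =>
          belowPoint n c z.1 b == (c.testBit (8 * e + b) && b != e)

/-- Test for the triangularity condition. -/
def triangularCode (n c : ℕ) (l : List (ℕ × ℕ)) (e : ℕ) : Bool :=
  l.any fun z => replaces n c l e z && (List.range n).all fun f =>
    f == e || (c.testBit (8 * f + e) == pointBelow n c f z.2 ||
      Nat.blt (weight n c l f) (weight n c l e))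

/-- Test for `Cert`. -/
def certCode (n c : ℕ) : Bool :=
  (downCodes n c).all (reduceCode n c (pairCodes n c)) &&
    (List.range n).all (triangularCode n c (pairCodes n c))

theorem any_range_iff {n : ℕ} {p : ℕ → Bool} :
    (List.range n).any p = true ↔ ∃ i : Fin n, p i = true := by
  simp [Fin.exists_iff]

theorem mem_upCodes {n c t : ℕ} :
    t ∈ upCodes n c ↔ t < 2 ^ n ∧ NonPrin (relOfCode n c) (setOfCode n t) := by
  rw [upCodes, List.mem_filter, List.mem_range, Bool.and_eq_true, isUpCode_iff, all_range_iff]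
  refine and_congr_right fun _ => and_congr_right fun _ => forall_congr' fun e => ?_
  rw [any_range_iff, Ne, Set.ext_iff, not_forall]
  refine exists_congr fun j => ?_
  rw [mem_row, mem_setOfCode, mem_relOfCode, bne_iff_ne, Ne, Bool.eq_iff_iff]

theorem mem_downCodes {n c s : ℕ} :
    s ∈ downCodes n c ↔ s < 2 ^ n ∧ NonPrin (transp (relOfCode n c)) (setOfCode n s) := by
  rw [downCodes, List.mem_filter, List.mem_range, Bool.and_eq_true, isDownCode_iff, all_range_iff]
  refine and_congr_right fun _ => and_congr_right fun _ => forall_congr' fun e => ?_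
  rw [any_range_iff, Ne, Set.ext_iff, not_forall]
  refine exists_congr fun j => ?_
  rw [mem_row, mem_transp, mem_setOfCode, mem_relOfCode, bne_iff_ne, Ne, Bool.eq_iff_iff]

theorem subCode_iff {n s t : ℕ} : subCode n s t = true ↔ setOfCode n s ⊆ setOfCode n t := by
  simp only [subCode, all_range_iff, Bool.or_eq_true, Bool.not_eq_true', ← Bool.not_eq_true,
    ← imp_iff_not_or]
  rfl

theorem belowPoint_iff {n c s : ℕ} {b : Fin n} :
    belowPoint n c s b = true ↔ ∀ a ∈ setOfCode n s, (a, b) ∈ relOfCode n c := by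
  simp only [belowPoint, all_range_iff, Bool.or_eq_true, Bool.not_eq_true', ← Bool.not_eq_true,
    ← imp_iff_not_or]
  rfl

theorem pointBelow_iff {n c t : ℕ} {f : Fin n} :
    pointBelow n c f t = true ↔ ∀ b ∈ setOfCode n t, (f, b) ∈ relOfCode n c := by
  simp only [pointBelow, all_range_iff, Bool.or_eq_true, Bool.not_eq_true', ← Bool.not_eq_true,
    ← imp_iff_not_or]
  rfl

theorem mem_pairCodes {n c : ℕ} {p : ℕ × ℕ} : p ∈ pairCodes n c ↔ (p.1 < 2 ^ n ∧ p.2 < 2 ^ n) ∧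
    ClosedPair (relOfCode n c) (setOfCode n p.1) (setOfCode n p.2) := by
  obtain ⟨s, t⟩ := p
  simp only [pairCodes, List.mem_filter, List.mem_product, mem_upCodes, mem_downCodes,
    Bool.and_eq_true, belowCode_iff, List.all_eq_true, Bool.or_eq_true, Bool.not_eq_true',
    ← Bool.not_eq_true, ← imp_iff_not_or, subCode_iff]
  constructor
  · rintro ⟨⟨⟨hs, hl⟩, ht, hr⟩, hb, h1, h2⟩
    refine ⟨⟨hs, ht⟩, hl, hr, hb, fun s' h h' => ?_, fun t' h h' => ?_⟩
    · obtain ⟨d, hd, rfl⟩ := exists_setOfCode s'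
      exact h1 d ⟨hd, h⟩ h'
    · obtain ⟨d, hd, rfl⟩ := exists_setOfCode t'
      exact h2 d ⟨hd, h⟩ h'
  · rintro ⟨⟨hs, ht⟩, h⟩
    exact ⟨⟨⟨hs, h.left⟩, ht, h.right⟩, h.below, fun d hd => h.maxLeft _ hd.2,
      fun d hd => h.maxRight _ hd.2⟩

/-- The closed pair with a given code. -/
def pairOfCode {n c : ℕ} (p : {p // p ∈ pairCodes n c}) : Pairs (relOfCode n c) :=
  ⟨(setOfCode n p.1.1, setOfCode n p.1.2), (mem_pairCodes.1 p.2).2⟩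

theorem pairOfCode_bijective {n c : ℕ} : Function.Bijective (pairOfCode (n := n) (c := c)) := by
  constructor
  · rintro ⟨⟨s, t⟩, hp⟩ ⟨⟨s', t'⟩, hp'⟩ h
    have h1 := congrArg (fun z : Pairs (relOfCode n c) => z.1.1) h
    have h2 := congrArg (fun z : Pairs (relOfCode n c) => z.1.2) h
    have hlt := (mem_pairCodes.1 hp).1
    have hlt' := (mem_pairCodes.1 hp').1
    obtain rfl : s = s' := setOfCode_inj hlt.1 hlt'.1 h1
    obtain rfl : t = t' := setOfCode_inj hlt.2 hlt'.2 h2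
    rfl
  · rintro ⟨⟨s, t⟩, h⟩
    obtain ⟨d, hd, rfl⟩ := exists_setOfCode s
    obtain ⟨d', hd', rfl⟩ := exists_setOfCode t
    exact ⟨⟨(d, d'), mem_pairCodes.2 ⟨⟨hd, hd'⟩, h⟩⟩, rfl⟩

theorem card_pairs {n c : ℕ} : Fintype.card (Pairs (relOfCode n c)) = (pairCodes n c).length := by
  have hnd : (pairCodes n c).Nodup :=
    ((List.nodup_range.filter _).product (List.nodup_range.filter _)).filter _
  rw [← Nat.card_eq_fintype_card, ← Nat.card_eq_of_bijective _ pairOfCode_bijective,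
    ← List.toFinset_card_of_nodup hnd, Nat.card_eq_fintype_card]
  exact Fintype.card_of_subtype _ (by simp)

theorem belowPoint_eq_iff {n c s : ℕ} {b : Fin n} {q : Bool} :
    (belowPoint n c s b == q) = true ↔
      ((∀ a ∈ setOfCode n s, (a, b) ∈ relOfCode n c) ↔ q = true) := by
  rw [beq_iff_eq, Bool.eq_iff_iff, belowPoint_iff]

theorem replaces_iff {n c : ℕ} (hR : IsPO (relOfCode n c)) {e : Fin n}
    {z : {p // p ∈ pairCodes n c}} : replaces n c (pairCodes n c) e z.1 = true ↔
      ∀ y : Pairs (relOfCode n c), Below (relOfCode n c) y.1.1 (row (relOfCode n c) e) ↔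
        Below (relOfCode n c) y.1.1 (pairOfCode z).1.2 := by
  rw [replaces, List.all_eq_true, pairOfCode_bijective.2.forall, Subtype.forall]
  refine forall_congr' fun y => forall_congr' fun hy => ?_
  rw [belowPoint_eq_iff, belowCode_iff]
  refine iff_congr ?_ Iff.rfl
  exact ⟨fun h a ha b hb => hR.trans (h a ha) hb, fun h a ha => h a ha e (hR.refl e)⟩

theorem cert_of_certCode {n c : ℕ} (hR : IsPO (relOfCode n c)) (h : certCode n c = true) :
    Cert (relOfCode n c) := by
  rw [certCode, Bool.and_eq_true, List.all_eq_true, all_range_iff] at h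
  refine ⟨fun s hs => ?_, fun e => weight n c (pairCodes n c) e, fun e => ?_⟩
  · obtain ⟨d, hd, rfl⟩ := exists_setOfCode s
    have h1 := h.1 d (mem_downCodes.2 ⟨hd, hs⟩)
    rw [reduceCode, Bool.or_eq_true, any_range_iff] at h1
    simp only [List.any_eq_true, Bool.and_eq_true,
      all_range_iff, belowPoint_eq_iff, belowPoint_iff, bne_iff_ne] at h1
    rcases h1 with ⟨z, hz, hsz⟩ | ⟨e, hse, z, hz, hez⟩
    · refine Or.inl ⟨pairOfCode ⟨z, hz⟩, fun t _ => ?_⟩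
      exact ⟨fun hb a ha b hbt => (hsz b).1 (fun a ha => hb a ha b hbt) a ha,
        fun hb a ha b hbt => (hsz b).2 (fun a ha => hb a ha b hbt) a ha⟩
    · refine Or.inr ⟨e, pairOfCode ⟨z, hz⟩, fun t ht => ?_⟩
      have hrow : Below (relOfCode n c) (row (transp (relOfCode n c)) e) t ↔
          ∀ b ∈ t, (e, b) ∈ relOfCode n c :=
        ⟨fun hb b hbt => hb e (hR.refl e) b hbt, fun hb a ha b hbt => hR.trans ha (hb b hbt)⟩
      have hswap : ∀ s : Set (Fin n), Below (relOfCode n c) s t ↔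
          ∀ b ∈ t, ∀ a ∈ s, (a, b) ∈ relOfCode n c :=
        fun s => ⟨fun hb b hbt a ha => hb a ha b hbt, fun hb a ha b hbt => hb b hbt a ha⟩
      rw [hrow, hswap, hswap]
      refine ⟨forall₂_congr fun b _ => hse b, ?_⟩
      change (∀ b ∈ t, ∀ a ∈ setOfCode n z.1, (a, b) ∈ relOfCode n c) ↔ _
      rw [forall₂_congr fun b _ => hez b]
      constructor
      · refine fun hb => ⟨fun b hbt => (hb b hbt).1, ?_⟩
        rintro rfl
        exact (hb e (hR.refl e)).2 rfl
      · rintro ⟨hb, hne⟩ b hbt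
        refine ⟨hb b hbt, fun hbe => hne (Set.Subset.antisymm hb fun a ha => ht b a hbt ?_)⟩
        rwa [Fin.ext hbe]
  · have h1 := h.2 e
    rw [triangularCode, List.any_eq_true] at h1
    obtain ⟨z, hz, h1⟩ := h1
    rw [Bool.and_eq_true, replaces_iff hR (z := ⟨z, hz⟩), all_range_iff] at h1
    refine ⟨pairOfCode ⟨z, hz⟩, h1.1, fun f hfe hn => ?_⟩
    have h2 := h1.2 f
    rw [Bool.or_eq_true, Bool.or_eq_true, beq_iff_eq, beq_iff_eq, Nat.blt_eq] at h2
    refine (h2.resolve_left fun h => hfe (Fin.ext h)).resolve_left fun heq => hn ?_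
    rw [mem_relOfCode, heq, pointBelow_iff]
    exact ⟨fun hb a ha b hbt => hR.trans ha (hb b hbt), fun hb b hbt => hb f (hR.refl f) b hbt⟩

theorem exists_mem_posetCodes {n : ℕ} (hn : n ≤ 8) {R : Set (Fin n × Fin n)} (hR : IsPO R) :
    ∃ c ∈ posetCodes n, relOfCode n c = R := by
  classical
  by_contra! h
  have h1 := sum_isPO (M := ℕ) hn fun R' => if R' = R then 1 else 0
  rw [Finset.sum_ite_eq', if_pos (by simpa using hR), List.sum_eq_zero] at h1
  · exact one_ne_zero h1
  · intro x hx
    obtain ⟨c, hc, rfl⟩ := List.mem_map.1 hx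
    exact if_neg (h c hc)

theorem IsPO.cert {n : ℕ} (hn : n < 5) {R : Set (Fin n × Fin n)} (hR : IsPO R) : Cert R := by
  obtain ⟨c, hc, rfl⟩ := exists_mem_posetCodes (by omega) hR
  refine cert_of_certCode hR ?_
  have key : ∀ n < 5, (posetCodes n).all (certCode n) = true := by decide +kernel
  exact List.all_eq_true.1 (key n hn) c hc

end PairCodes

section WordCount

/-- The number of words of length `p` on `b` letters which use `m` given letters. -/
def wordCount (p : ℕ) : ℕ → ℤ → ℤ
  | 0, b => b ^ p
  | m + 1, b => wordCount p m b - wordCount p m (b - 1)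

theorem card_words {A X : Type*} [Fintype A] [Fintype X] [DecidableEq A] [DecidableEq X]
    {S : Finset A} : ∀ {B : Finset A}, S ⊆ B →
      (((Fintype.piFinset fun _ : X => B).filter fun w => ∀ a ∈ S, ∃ x, w x = a).card : ℤ) =
        wordCount (Fintype.card X) S.card B.card := by
  induction S using Finset.induction_on with
  | empty => simp [wordCount]
  | insert a S ha ih =>
    intro B hB
    have haB : a ∈ B := hB (Finset.mem_insert_self a S)
    have hSB : S ⊆ B := (Finset.subset_insert a S).trans hB
    have hSe : S ⊆ B.erase a := Finset.subset_erase.2 ⟨hSB, ha⟩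
    rw [Finset.card_insert_of_notMem ha, wordCount, ← ih hSB, eq_sub_iff_add_eq,
      show (B.card : ℤ) - 1 = (B.erase a).card by
        rw [Finset.card_erase_of_mem haB, Nat.cast_pred (Finset.card_pos.2 ⟨a, haB⟩)], ← ih hSe]
    norm_cast
    rw [← Finset.card_union_of_disjoint]
    · congr 1
      ext w
      simp only [Finset.mem_union, Finset.mem_filter, Fintype.mem_piFinset, Finset.mem_erase,
        Finset.forall_mem_insert]
      by_cases hw : ∃ x, w x = a <;> grind
    · rw [Finset.disjoint_left]
      simp only [Finset.mem_filter, Fintype.mem_piFinset, Finset.mem_erase,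
        Finset.forall_mem_insert]
      grind

theorem card_ontoWord {E X : Type} [Fintype E] [Fintype X] (R : Set (E × E)) :
    (Nat.card (OntoWord R X) : ℤ) =
      wordCount (Fintype.card X) (Fintype.card E) (Fintype.card E + Fintype.card (Pairs R)) := by
  classical
  have h := card_words (X := X) (Finset.subset_univ
    ((Finset.univ : Finset E).map (Function.Embedding.inl (β := Pairs R))))
  rw [Finset.card_map, Finset.card_univ, Finset.card_univ, Fintype.card_sum, Nat.cast_add] at h
  rw [← h]
  change ((Nat.card {w : X → E ⊕ Pairs R // ∀ e, ∃ x, w x = Sum.inl e} : ℕ) : ℤ) = _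
  rw [Nat.card_eq_fintype_card]
  congr 1
  refine Fintype.card_of_subtype _ fun w => ?_
  simp

end WordCount

section Total

theorem card_goodTrips_eq {n : ℕ} (hn : n ≤ 8) (X : Type) [Fintype X] :
    (Nat.card (goodTrips n X) : ℤ) = ((posetCodes n).map fun c =>
      wordCount (Fintype.card X) n (n + (pairCodes n c).length) ^ 2).sum := by
  classical
  rw [card_goodTrips, ← Finset.sum_filter, Nat.cast_sum, sum_isPO hn]
  congr 2
  funext c
  rw [Nat.cast_pow, card_ontoWord, card_pairs, Fintype.card_fin]

end Total

section Final

theorem good_of_isPO (k : Type*) [Field k] {X : Type} [Fintype X]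
    (hX : Fintype.card X = 5) {n : ℕ} (hn : n < 6) {R : Set (Fin n × Fin n)} (hR : IsPO R) :
    Good k X R := by
  by_cases h : n < 5
  · exact (hR.cert h).good k hR
  · exact good_of_card_eq k hR (by rw [Fintype.card_fin, hX]; omega)

theorem wordCount_five (b : ℤ) : wordCount 5 5 b = 120 := by
  simp only [wordCount]
  ring

theorem card_goodTrips_of_lt {n : ℕ} (hn : n < 5) {X : Type} [Fintype X]
    (hX : Fintype.card X = 5) :
    Nat.card (goodTrips n X) = [1, 961, 389700, 8225100, 48816000].getD n 0 := by
  have key : ∀ n < 5, ((posetCodes n).map fun c =>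
      wordCount 5 n (n + (pairCodes n c).length) ^ 2).sum =
        ([1, 961, 389700, 8225100, 48816000].getD n 0 : ℕ) := by
    decide +kernel
  have h := card_goodTrips_eq (n := n) (by omega) X
  rw [hX, key n hn] at h
  exact_mod_cast h

theorem card_goodTrips_five {X : Type} [Fintype X] (hX : Fintype.card X = 5) :
    Nat.card (goodTrips 5 X) = 60926400 := by
  have key : (posetCodes 5).length = 4231 := by decide +kernel
  have h := card_goodTrips_eq (n := 5) (by omega) X
  rw [hX] at h
  simp only [Nat.cast_ofNat, wordCount_five, List.map_const', List.sum_replicate, key] at h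
  norm_num at h
  exact_mod_cast h

theorem sum_card_tripOrbit {X : Type} [Fintype X] (hX : Fintype.card X = 5) :
    ∑ m : Fin (Fintype.card X + 1), Nat.card (TripOrbit m X) = 4108382 := by
  have h := fun n (hn : n < 5) =>
    (card_tripOrbit n X).trans (card_goodTrips_of_lt hn hX)
  have h0 := h 0 (by omega)
  have h1 := h 1 (by omega)
  have h2 := h 2 (by omega)
  have h3 := h 3 (by omega)
  have h4 := h 4 (by omega)
  have h5 := (card_tripOrbit 5 X).trans (card_goodTrips_five hX)
  simp [Nat.factorial] at h0 h1 h2 h3 h4 h5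
  rw [Fin.sum_univ_eq_sum_range (fun m => Nat.card (TripOrbit m X)), hX]
  simp only [Finset.sum_range_succ, Finset.sum_range_zero]
  omega

end Final

/-- For a field `k` of characteristic zero and a set `X` with 5 elements, the Jacobson
radical `J(𝓡_X)` of the algebra of relations `𝓡_X = k𝓒(X,X)` has dimension 29446050
as a `k`-vector space. -/
theorem relAlgebra_jacobson_dim (k : Type) [Field k] [CharZero k]
    (X : Type) [Fintype X] (hX : Fintype.card X = 5) :
    Module.finrank k
      (Submodule.restrictScalars k
        (Ideal.jacobson (⊥ : Ideal (MonoidAlgebra k (Set (X × X)))))) = 29446050 := by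
  classical
  have hJ : Submodule.restrictScalars k
      (Ideal.jacobson (⊥ : Ideal (MonoidAlgebra k (Set (X × X))))) =
      (functionals k X).dualCoannihilator :=
    Submodule.ext fun a => mem_jacobson_iff_mem_coann a
  have : FiniteDimensional k (MonoidAlgebra k (Set (X × X))) :=
    Module.Finite.equiv (MonoidAlgebra.coeffLinearEquiv k).symm
  have hdim : Module.finrank k (MonoidAlgebra k (Set (X × X))) = 2 ^ 25 := by
    rw [(MonoidAlgebra.coeffLinearEquiv k).finrank_eq, Module.finrank_finsupp_self,
      ← Nat.card_eq_fintype_card, @Nat.card_eq_fintype_card _ Set.fintype, Fintype.card_set,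
      Fintype.card_prod, hX]
  have h1 := Subspace.finrank_add_finrank_dualCoannihilator_eq (functionals k X)
  have h2 : Module.finrank k (functionals k X) = 4108382 := by
    rw [finrank_functionals, sum_card_tripOrbit hX]
    exact fun m R hR => good_of_isPO k hX (by have := m.2; omega) hR
  rw [hdim, h2] at h1
  rw [hJ]
  omega
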